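/- arXiv:1308.5620 — 2 statements merged into one kernel-verified Lean document; each statement's English description precedes it below -/
import Mathlib

section
/- For all integers d ≥ 1, k ≥ 2, s ≥ 1 there exists C > 0 such that the following holds. Let V be a finite set of points in ℝ², let Γ₀ be a finite set of pairwise distinct plane algebraic curves of degree at most d with k degrees of freedom (any two distinct curves of Γ₀ have finite intersection, and any k distinct points of ℝ² lie on at most s curves of Γ₀), and let m : Γ₀ → ℕ be a multiplicity function with 1 ≤ m(γ) ≤ t for all γ ∈ Γ₀. Let M = Σ_{γ ∈ Γ₀} m(γ) be the total size of the multiset. Then the number of incidences counted with multiplicity, Σ_{γ ∈ Γ₀} m(γ)·|{p ∈ V : p ∈ γ}|, is at most C·(t^{1/(2k-1)}·|V|^{k/(2k-1)}·M^{(2k-2)/(2k-1)} + t·|V| + (1 + log₂ t)·M). -/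
section CellSampling

open Finset
open scoped Classical

/-- A system of cells for finite subfamilies of a family of curves: every subfamily `S` splits the
point set into quadratically many cells, each cell is determined by at most four members of `S`,
and no member of `S` crosses a cell. -/
structure CellDecomposition {P ι : Type*} (V : Finset P) (Γ : Finset ι) (Z : ι → Set P)
    (K : ℕ) where
  cell : Finset ι → P → Finset P
  subset : ∀ S p, cell S p ⊆ V
  mem_self : ∀ S, ∀ p ∈ V, p ∈ cell S p
  eq_of_mem : ∀ S, ∀ p ∈ V, ∀ q ∈ cell S p, cell S q = cell S p
  card_le : ∀ S ⊆ Γ, (V.image (cell S)).card ≤ K * (S.card + 1) ^ 2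
  exists_defining : ∀ S ⊆ Γ, ∀ p ∈ V, ∃ D : Finset ι, D.card ≤ 4 ∧
    ∀ γ ∈ S, γ ∉ D → cell (S.erase γ) p = cell S p
  mem_curve : ∀ S ⊆ Γ, ∀ γ ∈ S, ∀ p ∈ V, ∀ q ∈ cell S p, p ∈ Z γ → q ∈ Z γ

/-- The curve `c` meets the finite set `A` without containing it. -/
def Crosses {P : Type*} (c : Set P) (A : Finset P) : Prop :=
  (∃ p ∈ A, p ∈ c) ∧ ∃ q ∈ A, q ∉ c

lemma sum_powersetCard_insert {ι M : Type*} [AddCommMonoid M] (Γ : Finset ι) (r : ℕ)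
    (f : Finset ι → ι → M) :
    ∑ S ∈ Γ.powersetCard r, ∑ γ ∈ Γ \ S, f S γ =
      ∑ T ∈ Γ.powersetCard (r + 1), ∑ γ ∈ T, f (T.erase γ) γ := by
  rw [Finset.sum_sigma', Finset.sum_sigma']
  refine Finset.sum_bij' (fun x _ => ⟨insert x.2 x.1, x.2⟩) (fun x _ => ⟨x.1.erase x.2, x.2⟩)
    ?_ ?_ ?_ ?_ ?_
  · rintro ⟨S, γ⟩ h
    simp only [mem_sigma, mem_powersetCard, mem_sdiff] at h ⊢
    refine ⟨⟨insert_subset h.2.1 h.1.1, ?_⟩, mem_insert_self _ _⟩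
    rw [card_insert_of_notMem h.2.2, h.1.2]
  · rintro ⟨T, γ⟩ h
    simp only [mem_sigma, mem_powersetCard, mem_sdiff] at h ⊢
    refine ⟨⟨(erase_subset _ _).trans h.1.1, ?_⟩, h.1.1 h.2, notMem_erase _ _⟩
    rw [card_erase_of_mem h.2, h.1.2]; rfl
  · rintro ⟨S, γ⟩ h
    simp only [mem_sigma, mem_sdiff] at h
    simp [erase_insert h.2.2]
  · rintro ⟨T, γ⟩ h
    simp only [mem_sigma] at h
    simp [insert_erase h.2]
  · rintro ⟨S, γ⟩ h
    simp only [mem_sigma, mem_sdiff] at h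
    simp [erase_insert h.2.2]

namespace CellDecomposition

variable {P ι : Type*} {V : Finset P} {Γ : Finset ι} {Z : ι → Set P} {K : ℕ}

/-- The set of all cells of the subfamily `S`. -/
noncomputable def cells (𝒟 : CellDecomposition V Γ Z K) (S : Finset ι) : Finset (Finset P) :=
  V.image (𝒟.cell S)

lemma cell_eq_of_mem_cells (𝒟 : CellDecomposition V Γ Z K) {S : Finset ι} {A : Finset P}
    (hA : A ∈ 𝒟.cells S) {p : P} (hp : p ∈ A) : 𝒟.cell S p = A := by
  obtain ⟨q, hq, rfl⟩ := Finset.mem_image.1 hA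
  exact 𝒟.eq_of_mem S q hq p hp

lemma subset_of_mem_cells (𝒟 : CellDecomposition V Γ Z K) {S : Finset ι} {A : Finset P}
    (hA : A ∈ 𝒟.cells S) : A ⊆ V := by
  obtain ⟨q, hq, rfl⟩ := Finset.mem_image.1 hA
  exact 𝒟.subset S q

lemma sum_cells (𝒟 : CellDecomposition V Γ Z K) (S : Finset ι) {M : Type*} [AddCommMonoid M]
    (f : P → M) : ∑ A ∈ 𝒟.cells S, ∑ p ∈ A, f p = ∑ p ∈ V, f p := by
  rw [← Finset.sum_fiberwise_of_maps_to (s := V) (t := 𝒟.cells S) (g := 𝒟.cell S)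
    (fun p hp => Finset.mem_image_of_mem _ hp)]
  refine Finset.sum_congr rfl fun A hA => Finset.sum_congr ?_ fun _ _ => rfl
  ext p
  simp only [Finset.mem_filter]
  refine ⟨fun hp => ⟨𝒟.subset_of_mem_cells hA hp, 𝒟.cell_eq_of_mem_cells hA hp⟩, ?_⟩
  rintro ⟨hp, rfl⟩
  exact 𝒟.mem_self S p hp

lemma not_crosses (𝒟 : CellDecomposition V Γ Z K) {S : Finset ι} (hS : S ⊆ Γ) {γ : ι}
    (hγ : γ ∈ S) {A : Finset P} (hA : A ∈ 𝒟.cells S) : ¬ Crosses (Z γ) A := by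
  rintro ⟨⟨p, hp, hpγ⟩, q, hq, hqγ⟩
  refine hqγ (𝒟.mem_curve S hS γ hγ p (𝒟.subset_of_mem_cells hA hp) q ?_ hpγ)
  rwa [𝒟.cell_eq_of_mem_cells hA hp]

lemma notMem_cells_insert (𝒟 : CellDecomposition V Γ Z K) {S : Finset ι} (hS : S ⊆ Γ) {γ : ι}
    (hγ : γ ∈ Γ) {A : Finset P} (hc : Crosses (Z γ) A) :
    A ∉ 𝒟.cells (insert γ S) := fun h =>
  𝒟.not_crosses (Finset.insert_subset hγ hS) (Finset.mem_insert_self _ _) h hc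

lemma card_changed_le (𝒟 : CellDecomposition V Γ Z K) {T : Finset ι} (hT : T ⊆ Γ) {p : P}
    (hp : p ∈ V) : (T.filter fun γ => 𝒟.cell (T.erase γ) p ≠ 𝒟.cell T p).card ≤ 4 := by
  obtain ⟨D, hD, h⟩ := 𝒟.exists_defining T hT p hp
  refine (Finset.card_le_card fun γ hγ => ?_).trans hD
  rw [Finset.mem_filter] at hγ
  by_contra hγD
  exact hγ.2 (h γ hγ.1 hγD)

lemma sum_card_sdiff_le (𝒟 : CellDecomposition V Γ Z K) {T : Finset ι} (hT : T ⊆ Γ) :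
    ∑ γ ∈ T, (𝒟.cells T \ 𝒟.cells (T.erase γ)).card ≤ 4 * (𝒟.cells T).card := by
  calc ∑ γ ∈ T, (𝒟.cells T \ 𝒟.cells (T.erase γ)).card
      = ∑ γ ∈ T, ∑ A ∈ 𝒟.cells T, if A ∉ 𝒟.cells (T.erase γ) then 1 else 0 := by
        refine Finset.sum_congr rfl fun γ _ => ?_
        rw [← Finset.filter_notMem_eq_sdiff, Finset.card_filter]
    _ = ∑ A ∈ 𝒟.cells T, (T.filter fun γ => A ∉ 𝒟.cells (T.erase γ)).card := by
        rw [Finset.sum_comm]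
        simp only [Finset.card_filter]
    _ ≤ ∑ A ∈ 𝒟.cells T, 4 := by
        refine Finset.sum_le_sum fun A hA => ?_
        obtain ⟨p, hp, rfl⟩ := Finset.mem_image.1 hA
        refine (Finset.card_le_card ?_).trans (𝒟.card_changed_le hT hp)
        refine Finset.monotone_filter_right _ fun γ _ hγ h => hγ ?_
        rw [← h]
        exact Finset.mem_image_of_mem _ hp
    _ = 4 * (𝒟.cells T).card := by rw [Finset.sum_const, smul_eq_mul, mul_comm]

lemma sum_card_changed_le (𝒟 : CellDecomposition V Γ Z K) {T : Finset ι} (hT : T ⊆ Γ) :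
    ∑ γ ∈ T, (V.filter fun p => 𝒟.cell (T.erase γ) p ≠ 𝒟.cell T p).card ≤ 4 * V.card := by
  calc _ = ∑ p ∈ V, (T.filter fun γ => 𝒟.cell (T.erase γ) p ≠ 𝒟.cell T p).card := by
        simp only [Finset.card_filter]
        rw [Finset.sum_comm]
    _ ≤ ∑ p ∈ V, 4 := Finset.sum_le_sum fun p hp => 𝒟.card_changed_le hT hp
    _ = _ := by rw [Finset.sum_const, smul_eq_mul, mul_comm]

/-- Total weight `1 + w * #A` of the cells `A` of `S` crossed by `γ`. -/
noncomputable def crossWeight (𝒟 : CellDecomposition V Γ Z K) (w : ℝ) (S : Finset ι) (γ : ι) : ℝ :=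
  ∑ A ∈ (𝒟.cells S).filter (fun A => Crosses (Z γ) A), (1 + w * A.card)

lemma crossWeight_eq_zero (𝒟 : CellDecomposition V Γ Z K) (w : ℝ) {S : Finset ι} (hS : S ⊆ Γ)
    {γ : ι} (hγ : γ ∈ S) : 𝒟.crossWeight w S γ = 0 := by
  rw [crossWeight, Finset.filter_false_of_mem fun A hA => 𝒟.not_crosses hS hγ hA,
    Finset.sum_empty]

lemma crossWeight_le (𝒟 : CellDecomposition V Γ Z K) {w : ℝ} (hw : 0 ≤ w) {S : Finset ι}
    (hS : S ⊆ Γ) {γ : ι} (hγ : γ ∈ Γ) :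
    𝒟.crossWeight w S γ ≤
      (𝒟.cells S).card - (𝒟.cells (insert γ S)).card +
        (𝒟.cells (insert γ S) \ 𝒟.cells S).card +
        w * (V.filter fun p => 𝒟.cell S p ≠ 𝒟.cell (insert γ S) p).card := by
  have h1 : 𝒟.crossWeight w S γ ≤ ∑ A ∈ 𝒟.cells S \ 𝒟.cells (insert γ S), (1 + w * A.card) := by
    refine Finset.sum_le_sum_of_subset_of_nonneg (fun A hA => ?_) fun _ _ _ => by positivity
    rw [Finset.mem_filter] at hA
    exact Finset.mem_sdiff.2 ⟨hA.1, 𝒟.notMem_cells_insert hS hγ hA.2⟩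
  have h2 : ∑ A ∈ 𝒟.cells S \ 𝒟.cells (insert γ S), A.card ≤
      (V.filter fun p => 𝒟.cell S p ≠ 𝒟.cell (insert γ S) p).card := by
    rw [Finset.card_filter, ← 𝒟.sum_cells S]
    refine (Finset.sum_le_sum fun A hA => ?_).trans
      (Finset.sum_le_sum_of_subset Finset.sdiff_subset)
    rw [Finset.mem_sdiff] at hA
    rw [Finset.card_eq_sum_ones]
    refine Finset.sum_le_sum fun p hp => ?_
    rw [if_pos]
    rw [𝒟.cell_eq_of_mem_cells hA.1 hp]
    intro h
    refine hA.2 ?_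
    rw [h]
    exact Finset.mem_image_of_mem _ (𝒟.subset_of_mem_cells hA.1 hp)
  have h3 := Finset.card_sdiff_add_card_inter (𝒟.cells S) (𝒟.cells (insert γ S))
  have h4 := Finset.card_sdiff_add_card_inter (𝒟.cells (insert γ S)) (𝒟.cells S)
  rw [Finset.inter_comm] at h4
  refine h1.trans ?_
  rw [Finset.sum_add_distrib, ← Finset.mul_sum]
  have h2' : (∑ A ∈ 𝒟.cells S \ 𝒟.cells (insert γ S), (A.card : ℝ)) ≤
      (V.filter fun p => 𝒟.cell S p ≠ 𝒟.cell (insert γ S) p).card := by exact_mod_cast h2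
  have h3' : ((𝒟.cells S \ 𝒟.cells (insert γ S)).card : ℝ) +
    (𝒟.cells S ∩ 𝒟.cells (insert γ S)).card = (𝒟.cells S).card := by exact_mod_cast h3
  have h4' : ((𝒟.cells (insert γ S) \ 𝒟.cells S).card : ℝ) +
    (𝒟.cells S ∩ 𝒟.cells (insert γ S)).card = (𝒟.cells (insert γ S)).card := by exact_mod_cast h4
  have h5 := mul_le_mul_of_nonneg_left h2' hw
  simp only [Finset.sum_const, nsmul_eq_mul, mul_one]
  linarith

lemma sum_powersetCard_crossWeight_le (𝒟 : CellDecomposition V Γ Z K) {w : ℝ} (hw : 0 ≤ w)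
    {r : ℕ} (hr : r ≤ Γ.card) :
    ∑ S ∈ Γ.powersetCard r, ∑ γ ∈ Γ, 𝒟.crossWeight w S γ ≤
      ((Γ.card : ℝ) - r) * ∑ S ∈ Γ.powersetCard r, ((𝒟.cells S).card : ℝ)
        - (r + 1) * ∑ T ∈ Γ.powersetCard (r + 1), ((𝒟.cells T).card : ℝ)
        + 4 * ∑ T ∈ Γ.powersetCard (r + 1), ((𝒟.cells T).card : ℝ)
        + 4 * w * V.card * (Γ.card.choose (r + 1)) := by
  have h1 : ∑ S ∈ Γ.powersetCard r, ∑ γ ∈ Γ, 𝒟.crossWeight w S γ ≤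
      ∑ S ∈ Γ.powersetCard r, ∑ γ ∈ Γ \ S, (((𝒟.cells S).card : ℝ) +
        (- (𝒟.cells (insert γ S)).card +
        (𝒟.cells (insert γ S) \ 𝒟.cells S).card +
        w * (V.filter fun p => 𝒟.cell S p ≠ 𝒟.cell (insert γ S) p).card)) := by
    refine Finset.sum_le_sum fun S hS => ?_
    rw [Finset.mem_powersetCard] at hS
    rw [← Finset.sum_sdiff hS.1,
      Finset.sum_eq_zero (s := S) fun γ hγ => 𝒟.crossWeight_eq_zero w hS.1 hγ, add_zero]
    refine Finset.sum_le_sum fun γ hγ => ?_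
    have := 𝒟.crossWeight_le hw hS.1 (Finset.sdiff_subset hγ)
    linarith
  refine h1.trans ?_
  simp only [Finset.sum_add_distrib]
  rw [sum_powersetCard_insert Γ r (fun S γ => -((𝒟.cells (insert γ S)).card : ℝ)),
    sum_powersetCard_insert Γ r (fun S γ => ((𝒟.cells (insert γ S) \ 𝒟.cells S).card : ℝ)),
    sum_powersetCard_insert Γ r (fun S γ =>
      w * ((V.filter fun p => 𝒟.cell S p ≠ 𝒟.cell (insert γ S) p).card : ℝ))]
  have e1 : ∑ S ∈ Γ.powersetCard r, ∑ γ ∈ Γ \ S, ((𝒟.cells S).card : ℝ) =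
      ((Γ.card : ℝ) - r) * ∑ S ∈ Γ.powersetCard r, ((𝒟.cells S).card : ℝ) := by
    rw [Finset.mul_sum]
    refine Finset.sum_congr rfl fun S hS => ?_
    rw [Finset.mem_powersetCard] at hS
    rw [Finset.sum_const, nsmul_eq_mul, Finset.card_sdiff_of_subset hS.1, hS.2,
      Nat.cast_sub hr]
  have e2 : ∑ T ∈ Γ.powersetCard (r + 1), ∑ γ ∈ T,
      -((𝒟.cells (insert γ (T.erase γ))).card : ℝ) =
      - ((r + 1) * ∑ T ∈ Γ.powersetCard (r + 1), ((𝒟.cells T).card : ℝ)) := by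
    rw [Finset.mul_sum, ← Finset.sum_neg_distrib]
    refine Finset.sum_congr rfl fun T hT => ?_
    rw [Finset.mem_powersetCard] at hT
    rw [Finset.sum_congr rfl fun γ hγ => by rw [Finset.insert_erase hγ], Finset.sum_const, hT.2,
      nsmul_eq_mul]
    push_cast
    ring
  have e3 : ∑ T ∈ Γ.powersetCard (r + 1), ∑ γ ∈ T,
      ((𝒟.cells (insert γ (T.erase γ)) \ 𝒟.cells (T.erase γ)).card : ℝ) ≤
      4 * ∑ T ∈ Γ.powersetCard (r + 1), ((𝒟.cells T).card : ℝ) := by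
    rw [Finset.mul_sum]
    refine Finset.sum_le_sum fun T hT => ?_
    rw [Finset.mem_powersetCard] at hT
    rw [Finset.sum_congr rfl fun γ hγ => by rw [Finset.insert_erase hγ]]
    exact_mod_cast 𝒟.sum_card_sdiff_le hT.1
  have e4 : ∑ T ∈ Γ.powersetCard (r + 1), ∑ γ ∈ T,
      w * ((V.filter fun p =>
        𝒟.cell (T.erase γ) p ≠ 𝒟.cell (insert γ (T.erase γ)) p).card : ℝ) ≤
      4 * w * V.card * (Γ.card.choose (r + 1)) := by
    rw [← Finset.card_powersetCard, mul_comm, ← nsmul_eq_mul, ← Finset.sum_const]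
    refine Finset.sum_le_sum fun T hT => ?_
    rw [Finset.mem_powersetCard] at hT
    rw [Finset.sum_congr rfl fun γ hγ => by rw [Finset.insert_erase hγ], ← Finset.mul_sum,
      mul_comm 4 w, mul_assoc]
    refine mul_le_mul_of_nonneg_left ?_ hw
    exact_mod_cast 𝒟.sum_card_changed_le hT.1
  linarith

lemma average_identity {n r c c' a b w v : ℝ} (hr : 0 < r + 1)
    (h : c' * (r + 1) = c * (n - r)) :
    (n - r) * (a * c) - (r + 1) * (b * c') + 4 * (b * c') + 4 * w * v * c' =
      c * ((n - r) * (a - b + (4 * b / (r + 1) + 4 * w * v / (r + 1)))) := by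
  obtain rfl : c' = c * (n - r) / (r + 1) := by rw [← h]; field_simp
  field_simp
  ring

set_option maxHeartbeats 1000000 in
/-- A random sample of size about `R` leaves only few cell-curve crossings. -/
lemma exists_sample (𝒟 : CellDecomposition V Γ Z K) {w : ℝ} (hw : 0 ≤ w) {R : ℕ} (hR : 1 ≤ R)
    (hn : 2 * R ≤ Γ.card) :
    ∃ S ⊆ Γ, S.card ≤ 2 * R ∧
      ∑ γ ∈ Γ, 𝒟.crossWeight w S γ ≤ Γ.card * (36 * K * R + 4 * w * V.card / R) := by
  by_contra! hcon
  set n := Γ.card with hn_def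
  set e : ℕ → ℝ := fun r => (∑ S ∈ Γ.powersetCard r, ((𝒟.cells S).card : ℝ)) / n.choose r with he
  have hR0 : (1 : ℝ) ≤ R := by exact_mod_cast hR
  have hn0 : (0 : ℝ) < n := by exact_mod_cast (by omega : 0 < n)
  have he_le : ∀ r ≤ n, e r ≤ K * ((r : ℝ) + 1) ^ 2 := by
    intro r hr
    have hc : (0 : ℝ) < n.choose r := by exact_mod_cast Nat.choose_pos hr
    rw [he, div_le_iff₀ hc]
    calc ∑ S ∈ Γ.powersetCard r, ((𝒟.cells S).card : ℝ)
        ≤ ∑ S ∈ Γ.powersetCard r, K * ((r : ℝ) + 1) ^ 2 := by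
          refine Finset.sum_le_sum fun S hS => ?_
          rw [Finset.mem_powersetCard] at hS
          have := 𝒟.card_le S hS.1
          rw [hS.2] at this
          exact_mod_cast this
      _ = _ := by rw [Finset.sum_const, Finset.card_powersetCard, nsmul_eq_mul, mul_comm]
  have he0 : ∀ r, 0 ≤ e r := fun r =>
    div_nonneg (Finset.sum_nonneg fun _ _ => Nat.cast_nonneg _) (Nat.cast_nonneg _)
  set B : ℝ := 36 * K * R + 4 * w * V.card / R with hB
  have hB0 : 0 ≤ B := by positivity
  have step : ∀ r ∈ Finset.Ico R (2 * R),
      B < e r - e (r + 1) + (32 * K * R + 4 * w * V.card / R) := by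
    intro r hr
    rw [Finset.mem_Ico] at hr
    have hrn : r + 1 ≤ n := by omega
    have hc : (0 : ℝ) < n.choose r := by exact_mod_cast Nat.choose_pos (by omega : r ≤ n)
    have hc' : (0 : ℝ) < n.choose (r + 1) := by exact_mod_cast Nat.choose_pos hrn
    have hcc : (n.choose (r + 1) : ℝ) * (r + 1) = n.choose r * ((n : ℝ) - r) := by
      rw [← Nat.cast_sub (by omega : r ≤ n)]
      exact_mod_cast Nat.choose_succ_right_eq n r
    have hnr : (0 : ℝ) < (n : ℝ) - r := by
      have : ((r + 1 : ℕ) : ℝ) ≤ n := by exact_mod_cast hrn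
      push_cast at this; linarith
    have h1 := 𝒟.sum_powersetCard_crossWeight_le hw (by omega : r ≤ Γ.card)
    have h2 : (n.choose r : ℝ) * (n * B) ≤
        ∑ S ∈ Γ.powersetCard r, ∑ γ ∈ Γ, 𝒟.crossWeight w S γ := by
      rw [hn_def, ← Finset.card_powersetCard, ← nsmul_eq_mul, ← Finset.sum_const]
      refine Finset.sum_le_sum fun S hS => ?_
      rw [Finset.mem_powersetCard] at hS
      exact (hcon S hS.1 (by omega)).le
    have h2' : (n.choose r : ℝ) * (n * B) <
        ∑ S ∈ Γ.powersetCard r, ∑ γ ∈ Γ, 𝒟.crossWeight w S γ := by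
      rw [hn_def, ← Finset.card_powersetCard, ← nsmul_eq_mul, ← Finset.sum_const]
      refine Finset.sum_lt_sum_of_nonempty (Finset.powersetCard_nonempty.2 (by omega))
        fun S hS => ?_
      rw [Finset.mem_powersetCard] at hS
      exact hcon S hS.1 (by omega)
    have ea : ∑ S ∈ Γ.powersetCard r, ((𝒟.cells S).card : ℝ) = e r * n.choose r :=
      (div_mul_cancel₀ _ hc.ne').symm
    have eb : ∑ S ∈ Γ.powersetCard (r + 1), ((𝒟.cells S).card : ℝ) =
        e (r + 1) * n.choose (r + 1) :=
      (div_mul_cancel₀ _ hc'.ne').symm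
    rw [ea, eb] at h1
    have h3 : (n.choose r : ℝ) * (n * B) < n.choose r * (((n : ℝ) - r) *
        (e r - e (r + 1) + (4 * e (r + 1) / (r + 1) + 4 * w * V.card / (r + 1)))) := by
      refine h2'.trans_le (h1.trans (le_of_eq ?_))
      exact average_identity (Nat.cast_add_one_pos r) hcc
    have h4 := lt_of_mul_lt_mul_left h3 hc.le
    have hX : n * B < n * (e r - e (r + 1) +
        (4 * e (r + 1) / (r + 1) + 4 * w * V.card / (r + 1))) := by
      refine h4.trans_le ?_
      refine mul_le_mul_of_nonneg_right (by linarith [(Nat.cast_nonneg r : (0 : ℝ) ≤ r)]) ?_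
      by_contra! hneg
      have := mul_neg_of_pos_of_neg hnr hneg
      have : 0 ≤ n * B := mul_nonneg hn0.le hB0
      linarith
    have h6 := lt_of_mul_lt_mul_left hX hn0.le
    have hrR : (R : ℝ) ≤ r := by exact_mod_cast hr.1
    have hrR' : (r : ℝ) + 1 ≤ 2 * R := by exact_mod_cast hr.2
    have h7 : 4 * e (r + 1) / (r + 1) ≤ 32 * K * R := by
      rw [div_le_iff₀ (Nat.cast_add_one_pos r)]
      have h8 := he_le (r + 1) hrn
      push_cast at h8
      have h9 : ((r : ℝ) + 1 + 1) ^ 2 ≤ 8 * R * (r + 1) := by nlinarith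
      have := mul_le_mul_of_nonneg_left h9 (Nat.cast_nonneg K : (0 : ℝ) ≤ K)
      linarith
    have h8 : 4 * w * V.card / (r + 1) ≤ 4 * w * V.card / R := by
      exact div_le_div_of_nonneg_left
        (mul_nonneg (mul_nonneg zero_le_four hw) (Nat.cast_nonneg _)) (by linarith) (by linarith)
    linarith
  have hsum := Finset.sum_lt_sum_of_nonempty (s := Finset.Ico R (2 * R))
    (Finset.nonempty_Ico.2 (by omega)) step
  have htel : ∑ r ∈ Finset.Ico R (2 * R), (e r - e (r + 1)) = e R - e (2 * R) := by
    have := Finset.sum_Ico_sub e (by omega : R ≤ 2 * R)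
    rw [← neg_inj, ← Finset.sum_neg_distrib]
    simp only [neg_sub]
    exact this
  rw [Finset.sum_const, Finset.sum_add_distrib, htel, Finset.sum_const, Nat.card_Ico,
    nsmul_eq_mul, nsmul_eq_mul, show 2 * R - R = R by omega, hB] at hsum
  have h1 := he_le R (by omega)
  have h2 := he0 (2 * R)
  have h3 : ((R : ℝ) + 1) ^ 2 ≤ 4 * R * R := by nlinarith
  have h4 := mul_le_mul_of_nonneg_left h3 (Nat.cast_nonneg K : (0 : ℝ) ≤ K)
  nlinarith

end CellDecomposition

end CellSampling

section IncidenceCounting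

open Finset
open scoped Classical

variable {P ι : Type*}

/-- The number of curves of the family through a point. -/
noncomputable def curveDegree (Γ : Finset ι) (Z : ι → Set P) (p : P) : ℕ :=
  (Γ.filter fun γ => p ∈ Z γ).card

lemma sum_curveDegree (Γ : Finset ι) (Z : ι → Set P) (A : Finset P) :
    ∑ p ∈ A, curveDegree Γ Z p = ∑ γ ∈ Γ, (A.filter fun p => p ∈ Z γ).card := by
  simp only [curveDegree, Finset.card_filter]
  exact Finset.sum_comm

lemma sum_choose_le {A : Finset P} {G : Finset ι} {Z : ι → Set P} {k s : ℕ}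
    (h : ∀ T ⊆ A, T.card = k → (G.filter fun γ => ∀ p ∈ T, p ∈ Z γ).card ≤ s) :
    ∑ γ ∈ G, (A.filter fun p => p ∈ Z γ).card.choose k ≤ s * A.card.choose k := by
  calc ∑ γ ∈ G, (A.filter fun p => p ∈ Z γ).card.choose k
      = ∑ γ ∈ G, ((A.powersetCard k).filter fun T => ∀ p ∈ T, p ∈ Z γ).card := by
        refine Finset.sum_congr rfl fun γ _ => ?_
        rw [← Finset.card_powersetCard]
        congr 1
        ext T
        simp only [mem_powersetCard, mem_filter, subset_iff]
        constructor
        · exact fun hT => ⟨⟨fun p hp => (hT.1 hp).1, hT.2⟩, fun p hp => (hT.1 hp).2⟩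
        · exact fun hT => ⟨fun p hp => ⟨hT.1.1 hp, hT.2 p hp⟩, hT.1.2⟩
    _ = ∑ T ∈ A.powersetCard k, (G.filter fun γ => ∀ p ∈ T, p ∈ Z γ).card := by
        simp only [Finset.card_filter]
        exact Finset.sum_comm
    _ ≤ ∑ T ∈ A.powersetCard k, s := by
        refine Finset.sum_le_sum fun T hT => ?_
        rw [mem_powersetCard] at hT
        exact h T hT.1 hT.2
    _ = s * A.card.choose k := by
        rw [Finset.sum_const, Finset.card_powersetCard, smul_eq_mul, mul_comm]

lemma le_add_descFactorial (d : ℕ) {k : ℕ} (hk : 1 ≤ k) {L : ℝ} (hL : 0 < L) :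
    (d : ℝ) ≤ L + 2 * k + 2 ^ k * d.descFactorial k / L ^ (k - 1) := by
  have h0 : (0 : ℝ) ≤ 2 ^ k * d.descFactorial k / L ^ (k - 1) := by positivity
  by_cases h1 : (d : ℝ) ≤ L
  · have : (0 : ℝ) ≤ k := Nat.cast_nonneg k
    linarith
  by_cases h2 : d ≤ 2 * k
  · have : (d : ℝ) ≤ 2 * k := by exact_mod_cast h2
    linarith
  push Not at h1 h2
  suffices h : (d : ℝ) ≤ 2 ^ k * d.descFactorial k / L ^ (k - 1) by
    have : (0 : ℝ) ≤ k := Nat.cast_nonneg k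
    linarith
  have h3 : d ^ k ≤ 2 ^ k * d.descFactorial k := by
    calc d ^ k ≤ (2 * (d + 1 - k)) ^ k := Nat.pow_le_pow_left (by omega) k
      _ = 2 ^ k * (d + 1 - k) ^ k := mul_pow _ _ _
      _ ≤ _ := Nat.mul_le_mul_left _ (Nat.pow_sub_le_descFactorial d k)
  have h3' : (d : ℝ) ^ k ≤ 2 ^ k * d.descFactorial k := by exact_mod_cast h3
  rw [le_div_iff₀ (by positivity)]
  calc (d : ℝ) * L ^ (k - 1) ≤ d * d ^ (k - 1) := by gcongr
    _ = d ^ k := by rw [← pow_succ', Nat.sub_add_cancel hk]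
    _ ≤ _ := h3'

/-- A linearised Kővári–Sós–Turán bound. -/
lemma sum_card_filter_le {A : Finset P} {G : Finset ι} {Z : ι → Set P} {k s : ℕ} (hk : 1 ≤ k)
    (h : ∀ T ⊆ A, T.card = k → (G.filter fun γ => ∀ p ∈ T, p ∈ Z γ).card ≤ s)
    {L : ℝ} (hL : 0 < L) :
    ∑ γ ∈ G, ((A.filter fun p => p ∈ Z γ).card : ℝ) ≤
      G.card * (L + 2 * k) + 2 ^ k * s * A.card ^ k / L ^ (k - 1) := by
  have h1 : ∑ γ ∈ G, (A.filter fun p => p ∈ Z γ).card.descFactorial k ≤ s * A.card ^ k := by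
    simp only [Nat.descFactorial_eq_factorial_mul_choose]
    rw [← Finset.mul_sum]
    calc _ ≤ k.factorial * (s * A.card.choose k) := Nat.mul_le_mul_left _ (sum_choose_le h)
      _ = s * A.card.descFactorial k := by
        rw [Nat.descFactorial_eq_factorial_mul_choose]; ring
      _ ≤ _ := Nat.mul_le_mul_left _ (Nat.descFactorial_le_pow _ _)
  have h1' : ∑ γ ∈ G, ((A.filter fun p => p ∈ Z γ).card.descFactorial k : ℝ) ≤
      s * A.card ^ k := by exact_mod_cast h1
  calc ∑ γ ∈ G, ((A.filter fun p => p ∈ Z γ).card : ℝ)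
      ≤ ∑ γ ∈ G, (L + 2 * k + 2 ^ k * ((A.filter fun p => p ∈ Z γ).card.descFactorial k)
          / L ^ (k - 1)) := Finset.sum_le_sum fun γ _ => le_add_descFactorial _ hk hL
    _ = G.card * (L + 2 * k) + 2 ^ k *
          (∑ γ ∈ G, ((A.filter fun p => p ∈ Z γ).card.descFactorial k : ℝ)) / L ^ (k - 1) := by
        rw [Finset.sum_add_distrib, Finset.sum_const, nsmul_eq_mul, ← Finset.sum_div,
          ← Finset.mul_sum]
    _ ≤ _ := by
        rw [mul_assoc (2 ^ k : ℝ)]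
        gcongr

lemma sum_curveDegree_pairs_le {V : Finset P} {Γ : Finset ι} {Z : ι → Set P} {D : ℕ}
    (hD : ∀ α ∈ Γ, ∀ β ∈ Γ, α ≠ β → (V.filter fun p => p ∈ Z α ∧ p ∈ Z β).card ≤ D) :
    ∑ p ∈ V, curveDegree Γ Z p * (curveDegree Γ Z p - 1) ≤ D * Γ.card ^ 2 := by
  calc ∑ p ∈ V, curveDegree Γ Z p * (curveDegree Γ Z p - 1)
      = ∑ p ∈ V, (Γ.offDiag.filter fun x => p ∈ Z x.1 ∧ p ∈ Z x.2).card := by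
        refine Finset.sum_congr rfl fun p _ => ?_
        rw [Nat.mul_sub_one, curveDegree, ← Finset.offDiag_card]
        congr 1
        ext x
        simp only [mem_offDiag, mem_filter]
        tauto
    _ = ∑ x ∈ Γ.offDiag, (V.filter fun p => p ∈ Z x.1 ∧ p ∈ Z x.2).card := by
        simp only [Finset.card_filter]
        exact Finset.sum_comm
    _ ≤ ∑ x ∈ Γ.offDiag, D := by
        refine Finset.sum_le_sum fun x hx => ?_
        rw [mem_offDiag] at hx
        exact hD _ hx.1 _ hx.2.1 hx.2.2
    _ = (Γ.card * Γ.card - Γ.card) * D := by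
        rw [Finset.sum_const, Finset.offDiag_card, smul_eq_mul]
    _ ≤ _ := by
        rw [mul_comm, sq]
        exact Nat.mul_le_mul_left _ (Nat.sub_le _ _)

/-- Incidences inside a single cell. -/
lemma sum_curveDegree_cell_le {A : Finset P} {Γ : Finset ι} {Z : ι → Set P} {D k s : ℕ}
    (hk : 1 ≤ k)
    (hD : ∀ α ∈ Γ, ∀ β ∈ Γ, α ≠ β → (A.filter fun p => p ∈ Z α ∧ p ∈ Z β).card ≤ D)
    (hs : ∀ T ⊆ A, T.card = k → (Γ.filter fun γ => ∀ p ∈ T, p ∈ Z γ).card ≤ s)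
    {u w : ℝ} (hu : 0 ≤ u) (hw : 0 < w) (hdeg : ∀ p ∈ A, (curveDegree Γ Z p : ℝ) ≤ u) :
    ∑ p ∈ A, (curveDegree Γ Z p : ℝ) ≤ D * u + A.card +
      ((Γ.filter fun γ => Crosses (Z γ) A).card * (A.card / w + 2 * k) +
        2 ^ k * s * (A.card * w ^ (k - 1))) := by
  set N := (Γ.filter fun γ => Crosses (Z γ) A).card with hN
  have hnn : (0 : ℝ) ≤ N * (A.card / w + 2 * k) + 2 ^ k * s * (A.card * w ^ (k - 1)) := by
    positivity
  have hAnn : (0 : ℝ) ≤ A.card := Nat.cast_nonneg _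
  by_cases hA : A.card ≤ D
  · have h1 : ∑ p ∈ A, (curveDegree Γ Z p : ℝ) ≤ A.card * u := by
      rw [← nsmul_eq_mul, ← Finset.sum_const]
      exact Finset.sum_le_sum hdeg
    have h2 : (A.card : ℝ) * u ≤ D * u := by
      have : (A.card : ℝ) ≤ D := by exact_mod_cast hA
      gcongr
    linarith
  push Not at hA
  have hA0 : (0 : ℝ) < A.card := by exact_mod_cast (by omega : 0 < A.card)
  have e : ∑ p ∈ A, (curveDegree Γ Z p : ℝ) = ∑ γ ∈ Γ, ((A.filter fun p => p ∈ Z γ).card : ℝ) := by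
    exact_mod_cast sum_curveDegree Γ Z A
  rw [e, ← Finset.sum_filter_add_sum_filter_not Γ (fun γ => Crosses (Z γ) A)]
  have h1 : ∑ γ ∈ Γ.filter (fun γ => Crosses (Z γ) A), ((A.filter fun p => p ∈ Z γ).card : ℝ) ≤
      N * (A.card / w + 2 * k) + 2 ^ k * s * (A.card * w ^ (k - 1)) := by
    refine (sum_card_filter_le (s := s) hk (fun T hT hTk => ?_) (div_pos hA0 hw)).trans
      (le_of_eq ?_)
    · refine (Finset.card_le_card ?_).trans (hs T hT hTk)
      exact Finset.filter_subset_filter _ (Finset.filter_subset _ _)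
    · rw [mul_div_assoc, div_pow, div_div_eq_mul_div]
      congr 2
      rw [div_eq_iff (by positivity)]
      have : (A.card : ℝ) ^ k = A.card * A.card ^ (k - 1) := by
        rw [← pow_succ', Nat.sub_add_cancel hk]
      rw [this]
      ring
  have h2 : ∑ γ ∈ Γ.filter (fun γ => ¬ Crosses (Z γ) A), ((A.filter fun p => p ∈ Z γ).card : ℝ) ≤
      A.card := by
    by_cases hex : ∃ α ∈ Γ, ∀ p ∈ A, p ∈ Z α
    · obtain ⟨α, hα, hαA⟩ := hex
      calc ∑ γ ∈ Γ.filter (fun γ => ¬ Crosses (Z γ) A), ((A.filter fun p => p ∈ Z γ).card : ℝ)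
          ≤ ∑ γ ∈ Γ.filter (fun γ => ¬ Crosses (Z γ) A), if γ = α then (A.card : ℝ) else 0 := by
            refine Finset.sum_le_sum fun γ hγ => ?_
            rw [mem_filter] at hγ
            split_ifs with h
            · exact_mod_cast Finset.card_filter_le _ _
            · rw [Finset.filter_false_of_mem]
              · simp
              · intro p hp hpγ
                have hall : ∀ q ∈ A, q ∈ Z γ := by
                  by_contra! hq
                  exact hγ.2 ⟨⟨p, hp, hpγ⟩, hq⟩
                have := hD γ hγ.1 α hα h
                rw [Finset.filter_true_of_mem fun q hq => ⟨hall q hq, hαA q hq⟩] at this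
                omega
        _ ≤ A.card := by
            rw [Finset.sum_ite_eq']
            split_ifs <;> simp
    · rw [Finset.sum_eq_zero]
      · exact hAnn
      · intro γ hγ
        rw [mem_filter] at hγ
        rw [Finset.filter_false_of_mem]
        · simp
        · intro p hp hpγ
          refine hex ⟨γ, hγ.1, ?_⟩
          by_contra! hq
          exact hγ.2 ⟨⟨p, hp, hpγ⟩, hq⟩
  have h3 : (0 : ℝ) ≤ D * u := by positivity
  linarith

/-- Incidences with points of low degree. -/
lemma sum_curveDegree_light_le {V : Finset P} {Γ : Finset ι} {Z : ι → Set P} {D k s K : ℕ}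
    (hk : 1 ≤ k) (𝒟 : CellDecomposition V Γ Z K)
    (hD : ∀ α ∈ Γ, ∀ β ∈ Γ, α ≠ β → (V.filter fun p => p ∈ Z α ∧ p ∈ Z β).card ≤ D)
    (hs : ∀ T ⊆ V, T.card = k → (Γ.filter fun γ => ∀ p ∈ T, p ∈ Z γ).card ≤ s)
    {R : ℕ} (hR : 1 ≤ R) (hn : 2 * R ≤ Γ.card) {w : ℝ} (hw : 1 ≤ w)
    (hwk : w ^ k = Γ.card / R)
    (hdeg : ∀ p ∈ V, (curveDegree Γ Z p : ℝ) ≤ Γ.card / R) :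
    ∑ p ∈ V, (curveDegree Γ Z p : ℝ) ≤
      (9 * K * D + 2 * k * (36 * K + 4)) * (Γ.card * R) +
        (1 + (36 * K + 4) + 2 ^ k * s) * (V.card * w ^ (k - 1)) := by
  rcases V.eq_empty_or_nonempty with rfl | hV
  · simp only [Finset.sum_empty]
    positivity
  have hR0 : (1 : ℝ) ≤ R := by exact_mod_cast hR
  have hm : (0 : ℝ) < V.card := by exact_mod_cast hV.card_pos
  have hw0 : 0 < w := by linarith
  set b : ℝ := R ^ 2 / V.card with hb
  have hb0 : 0 < b := by positivity
  obtain ⟨S, hS, hSc, hsum⟩ := 𝒟.exists_sample hb0.le hR hn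
  set N : Finset P → ℝ := fun A => ((Γ.filter fun γ => Crosses (Z γ) A).card : ℝ) with hNdef
  have hN0 : ∀ A, 0 ≤ N A := fun A => Nat.cast_nonneg _
  have e1 : ∑ γ ∈ Γ, 𝒟.crossWeight b S γ = ∑ A ∈ 𝒟.cells S, N A * (1 + b * A.card) := by
    simp only [CellDecomposition.crossWeight, Finset.sum_filter]
    rw [Finset.sum_comm]
    refine Finset.sum_congr rfl fun A _ => ?_
    rw [← Finset.sum_filter, Finset.sum_const, nsmul_eq_mul]
  have e2 : 4 * b * V.card / R = 4 * R := by
    rw [hb]; field_simp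
  rw [e1, e2] at hsum
  have hc1 : ∑ A ∈ 𝒟.cells S, N A ≤ (36 * K + 4) * (Γ.card * R) := by
    refine (Finset.sum_le_sum fun A _ => ?_).trans (hsum.trans (le_of_eq (by ring)))
    have : 0 ≤ N A * (b * A.card) := mul_nonneg (hN0 A) (by positivity)
    linarith
  have hc2 : ∑ A ∈ 𝒟.cells S, N A * A.card ≤ (36 * K + 4) * (V.card * w ^ k) := by
    have : b * ∑ A ∈ 𝒟.cells S, N A * A.card ≤ (36 * K + 4) * (Γ.card * R) := by
      rw [Finset.mul_sum]
      refine (Finset.sum_le_sum fun A _ => ?_).trans (hsum.trans (le_of_eq (by ring)))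
      linarith [hN0 A]
    rw [mul_comm, ← le_div_iff₀ hb0] at this
    refine this.trans (le_of_eq ?_)
    rw [hwk, hb]
    field_simp
  have hcells : ((𝒟.cells S).card : ℝ) ≤ K * (9 * R ^ 2) := by
    have h1 : ((𝒟.cells S).card : ℝ) ≤ K * ((S.card : ℝ) + 1) ^ 2 := by
      exact_mod_cast 𝒟.card_le S hS
    have h2 : (S.card : ℝ) + 1 ≤ 3 * R := by
      have : (S.card : ℝ) ≤ 2 * R := by exact_mod_cast hSc
      linarith
    refine h1.trans (mul_le_mul_of_nonneg_left ?_ (Nat.cast_nonneg K))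
    calc ((S.card : ℝ) + 1) ^ 2 ≤ (3 * (R : ℝ)) ^ 2 := by gcongr
      _ = 9 * (R : ℝ) ^ 2 := by ring
  have hcard : ∑ A ∈ 𝒟.cells S, (A.card : ℝ) = V.card := by
    have := 𝒟.sum_cells S (fun _ => (1 : ℝ))
    simpa using this
  have hu : (0 : ℝ) ≤ Γ.card / R := by positivity
  have hcell : ∀ A ∈ 𝒟.cells S, ∑ p ∈ A, (curveDegree Γ Z p : ℝ) ≤
      D * (Γ.card / R) + A.card + (N A * (A.card / w + 2 * k) +
        2 ^ k * s * (A.card * w ^ (k - 1))) := by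
    intro A hA
    have hAV := 𝒟.subset_of_mem_cells hA
    refine sum_curveDegree_cell_le hk (fun α hα β hβ h => ?_) (fun T hT => hs T (hT.trans hAV))
      hu hw0 fun p hp => hdeg p (hAV hp)
    exact (Finset.card_le_card (Finset.filter_subset_filter _ hAV)).trans (hD α hα β hβ h)
  rw [← 𝒟.sum_cells S]
  refine (Finset.sum_le_sum hcell).trans ?_
  have e3 : ∑ A ∈ 𝒟.cells S, (D * (Γ.card / R) + A.card + (N A * (A.card / w + 2 * k) +
        2 ^ k * s * (A.card * w ^ (k - 1)))) =
      (𝒟.cells S).card * (D * (Γ.card / R)) + ∑ A ∈ 𝒟.cells S, (A.card : ℝ) +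
      ((∑ A ∈ 𝒟.cells S, N A * A.card) / w + (∑ A ∈ 𝒟.cells S, N A) * (2 * k) +
        2 ^ k * s * ((∑ A ∈ 𝒟.cells S, (A.card : ℝ)) * w ^ (k - 1))) := by
    simp only [Finset.sum_add_distrib, mul_add, Finset.sum_const, nsmul_eq_mul, Finset.sum_mul,
      Finset.mul_sum, Finset.sum_div, mul_div_assoc]
  rw [e3, hcard]
  have hwp : w ^ k = w * w ^ (k - 1) := by rw [← pow_succ', Nat.sub_add_cancel hk]
  have hw1 : 1 ≤ w ^ (k - 1) := one_le_pow₀ hw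
  have f1 : ((𝒟.cells S).card : ℝ) * (D * (Γ.card / R)) ≤ 9 * K * D * (Γ.card * R) := by
    refine (mul_le_mul_of_nonneg_right hcells (by positivity)).trans (le_of_eq ?_)
    field_simp
  have f2 : (V.card : ℝ) ≤ V.card * w ^ (k - 1) := le_mul_of_one_le_right hm.le hw1
  have f3 : (∑ A ∈ 𝒟.cells S, N A * A.card) / w ≤ (36 * K + 4) * (V.card * w ^ (k - 1)) := by
    rw [div_le_iff₀ hw0]
    refine hc2.trans (le_of_eq ?_)
    rw [hwp]; ring
  have f4 : (∑ A ∈ 𝒟.cells S, N A) * (2 * k) ≤ 2 * k * (36 * K + 4) * (Γ.card * R) := by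
    refine (mul_le_mul_of_nonneg_right hc1 (by positivity)).trans (le_of_eq (by ring))
  linarith

/-- Incidences with points of high degree. -/
lemma sum_curveDegree_heavy_le {V : Finset P} {Γ : Finset ι} {Z : ι → Set P} {D : ℕ}
    (hD : ∀ α ∈ Γ, ∀ β ∈ Γ, α ≠ β → (V.filter fun p => p ∈ Z α ∧ p ∈ Z β).card ≤ D)
    {R : ℕ} (hR : 1 ≤ R) (hn : 2 * R ≤ Γ.card) :
    ∑ p ∈ V with ¬ (curveDegree Γ Z p : ℝ) ≤ Γ.card / R, (curveDegree Γ Z p : ℝ) ≤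
      2 * D * (Γ.card * R) := by
  have hR0 : (0 : ℝ) < R := by exact_mod_cast hR
  have hn0 : (0 : ℝ) < Γ.card := by exact_mod_cast (by omega : 0 < Γ.card)
  have hnR : (2 : ℝ) ≤ Γ.card / R := by
    rw [le_div_iff₀ hR0]
    exact_mod_cast hn
  have h1 : ∀ p ∈ V.filter (fun p => ¬ (curveDegree Γ Z p : ℝ) ≤ Γ.card / R), (curveDegree Γ Z p : ℝ) ≤
      2 * R / Γ.card * ((curveDegree Γ Z p * (curveDegree Γ Z p - 1) : ℕ) : ℝ) := by
    intro p hp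
    rw [mem_filter, not_le] at hp
    set x := curveDegree Γ Z p
    have hx2 : (2 : ℝ) < x := hnR.trans_lt hp.2
    have hx : 2 < x := by exact_mod_cast hx2
    rw [Nat.cast_mul, Nat.cast_sub (by omega), Nat.cast_one, div_mul_eq_mul_div,
      le_div_iff₀ hn0]
    have h2 : (Γ.card : ℝ) < x * R := by
      have := hp.2
      rwa [div_lt_iff₀ hR0] at this
    nlinarith
  refine (Finset.sum_le_sum h1).trans ?_
  rw [← Finset.mul_sum]
  have h2 : ∑ p ∈ V with ¬ (curveDegree Γ Z p : ℝ) ≤ Γ.card / R,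
      ((curveDegree Γ Z p * (curveDegree Γ Z p - 1) : ℕ) : ℝ) ≤ D * (Γ.card : ℝ) ^ 2 := by
    refine (Finset.sum_le_sum_of_subset_of_nonneg (Finset.filter_subset _ _)
      fun _ _ _ => Nat.cast_nonneg _).trans ?_
    exact_mod_cast sum_curveDegree_pairs_le hD
  refine (mul_le_mul_of_nonneg_left h2 (by positivity)).trans (le_of_eq ?_)
  field_simp

lemma sum_curveDegree_le_of_sample {V : Finset P} {Γ : Finset ι} {Z : ι → Set P} {D k s K : ℕ}
    (hk : 1 ≤ k) (h𝒟 : ∀ V' ⊆ V, Nonempty (CellDecomposition V' Γ Z K))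
    (hD : ∀ α ∈ Γ, ∀ β ∈ Γ, α ≠ β → (V.filter fun p => p ∈ Z α ∧ p ∈ Z β).card ≤ D)
    (hs : ∀ T ⊆ V, T.card = k → (Γ.filter fun γ => ∀ p ∈ T, p ∈ Z γ).card ≤ s)
    {R : ℕ} (hR : 1 ≤ R) (hn : 2 * R ≤ Γ.card) {w : ℝ} (hw : 1 ≤ w)
    (hwk : w ^ k = Γ.card / R) :
    ∑ p ∈ V, (curveDegree Γ Z p : ℝ) ≤
      (2 * D + 9 * K * D + 2 * k * (36 * K + 4)) * (Γ.card * R) +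
        (1 + (36 * K + 4) + 2 ^ k * s) * (V.card * w ^ (k - 1)) := by
  rw [← Finset.sum_filter_add_sum_filter_not V
    (fun p => (curveDegree Γ Z p : ℝ) ≤ Γ.card / R)]
  set V' := V.filter fun p => (curveDegree Γ Z p : ℝ) ≤ Γ.card / R with hV'
  have hV'V : V' ⊆ V := Finset.filter_subset _ _
  obtain ⟨𝒟⟩ := h𝒟 V' hV'V
  have h1 := sum_curveDegree_light_le hk 𝒟
    (fun α hα β hβ h => (Finset.card_le_card (Finset.filter_subset_filter _ hV'V)).trans
      (hD α hα β hβ h)) (fun T hT => hs T (hT.trans hV'V)) hR hn hw hwk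
    (fun p hp => (Finset.mem_filter.1 hp).2)
  have h2 := sum_curveDegree_heavy_le hD hR hn
  have h3 : (V'.card : ℝ) ≤ V.card := by exact_mod_cast Finset.card_le_card hV'V
  have h4 : (1 + (36 * K + 4) + 2 ^ k * s) * (V'.card * w ^ (k - 1)) ≤
      (1 + (36 * K + 4) + 2 ^ k * s) * (V.card * w ^ (k - 1)) := by gcongr
  linarith

set_option maxHeartbeats 1000000 in
/-- The Pach–Sharir incidence bound for families of curves that admit cell decompositions. -/
theorem exists_incidence_bound (P ι : Type*) (k s D K : ℕ) (hk : 1 ≤ k) :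
    ∃ C : ℝ, 0 < C ∧ ∀ (V : Finset P) (Γ : Finset ι) (Z : ι → Set P),
      (∀ V' ⊆ V, Nonempty (CellDecomposition V' Γ Z K)) →
      (∀ α ∈ Γ, ∀ β ∈ Γ, α ≠ β → (V.filter fun p => p ∈ Z α ∧ p ∈ Z β).card ≤ D) →
      (∀ T ⊆ V, T.card = k → (Γ.filter fun γ => ∀ p ∈ T, p ∈ Z γ).card ≤ s) →
      ∑ γ ∈ Γ, ((V.filter fun p => p ∈ Z γ).card : ℝ) ≤
        C * ((V.card : ℝ) ^ ((k : ℝ) / (2 * (k : ℝ) - 1)) *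
          (Γ.card : ℝ) ^ ((2 * (k : ℝ) - 2) / (2 * (k : ℝ) - 1)) + V.card + Γ.card) := by
  set C₁ : ℝ := 2 * D + 9 * K * D + 2 * k * (36 * K + 4) with hC₁
  set C₂ : ℝ := 1 + (36 * K + 4) + 2 ^ k * s with hC₂
  have hC₁0 : 0 ≤ C₁ := by positivity
  have hC₂1 : 1 ≤ C₂ := by
    have : (0 : ℝ) ≤ 36 * K + 4 + 2 ^ k * s := by positivity
    linarith
  set CC : ℝ := 2 * C₁ + C₂ + (1 + 2 * k + 2 ^ k * s) + 4 * D with hCC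
  have hCC0 : 0 ≤ CC := by positivity
  refine ⟨CC, by positivity, ?_⟩
  intro V Γ Z h𝒟 hD hs
  set Q : ℝ := (V.card : ℝ) ^ ((k : ℝ) / (2 * (k : ℝ) - 1)) *
          (Γ.card : ℝ) ^ ((2 * (k : ℝ) - 2) / (2 * (k : ℝ) - 1)) with hQ
  have hQ0 : 0 ≤ Q := by positivity
  rcases V.eq_empty_or_nonempty with rfl | hV
  · simp only [Finset.filter_empty, Finset.card_empty, Nat.cast_zero, Finset.sum_const_zero]
    positivity
  rcases Γ.eq_empty_or_nonempty with rfl | hΓ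
  · simp only [Finset.sum_empty]
    positivity
  have hm : (1 : ℝ) ≤ V.card := by exact_mod_cast hV.card_pos
  have hn : (1 : ℝ) ≤ Γ.card := by exact_mod_cast hΓ.card_pos
  set m : ℝ := (V.card : ℝ) with hmdef
  set n : ℝ := (Γ.card : ℝ) with hndef
  have hk1 : (1 : ℝ) ≤ k := by exact_mod_cast hk
  have hd : (0 : ℝ) < 2 * k - 1 := by linarith
  have hds : (0 : ℝ) ≤ 2 ^ k * s := by positivity
  -- the optimal sample size
  set R₀ : ℝ := (m ^ k / n) ^ ((1 : ℝ) / (2 * k - 1)) with hR₀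
  have hR₀0 : 0 < R₀ := by positivity
  have hR₀p : R₀ ^ (2 * k - 1) * n = m ^ k := by
    have : R₀ ^ (2 * k - 1) = m ^ k / n := by
      rw [hR₀, ← Real.rpow_natCast, ← Real.rpow_mul (by positivity),
        Nat.cast_sub (by omega)]
      push_cast
      rw [one_div, inv_mul_cancel₀ hd.ne', Real.rpow_one]
    rw [this]
    field_simp
  have hQR : Q = n * R₀ := by
    rw [hQ, hR₀, Real.div_rpow (by positivity) (by positivity), ← Real.rpow_natCast m k,
      ← Real.rpow_mul (by positivity), mul_one_div, mul_div_assoc', mul_comm n, mul_div_assoc]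
    congr 1
    nth_rewrite 2 [← Real.rpow_one n]
    rw [← Real.rpow_sub (by positivity)]
    congr 1
    field_simp
    ring
  have e : ∑ γ ∈ Γ, ((V.filter fun p => p ∈ Z γ).card : ℝ) = ∑ p ∈ V, (curveDegree Γ Z p : ℝ) := by
    exact_mod_cast (sum_curveDegree Γ Z V).symm
  have hDn : (0 : ℝ) ≤ D := Nat.cast_nonneg D
  by_cases hR1 : R₀ < 1
  · have h1 := sum_card_filter_le hk hs one_pos
    have h2 : m ^ k ≤ n := by
      rw [← hR₀p]
      exact mul_le_of_le_one_left (by positivity) (pow_le_one₀ hR₀0.le hR1.le)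
    refine h1.trans ?_
    rw [one_pow, div_one, ← hmdef, ← hndef]
    have h3 : 2 ^ k * s * m ^ k ≤ 2 ^ k * s * n := mul_le_mul_of_nonneg_left h2 hds
    have h4 : (1 + 2 * k + 2 ^ k * s) * (m + n) ≤ CC * (Q + m + n) :=
      mul_le_mul (by linarith only [hC₁0, hC₂1, hDn, hCC]) (by linarith only [hQ0])
        (by linarith only [hm, hn]) hCC0
    have h5 : (2 * k + 2 ^ k * s) * m ≥ 0 := by positivity
    have h6 : 0 ≤ m := by linarith only [hm]
    linarith only [h3, h4, h5, h6]
  push Not at hR1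
  by_cases hR2 : n ≤ 4 * R₀
  · have h1 : ∑ p ∈ V, (curveDegree Γ Z p : ℝ) ≤ m + D * n ^ 2 := by
      have h2 : ∑ p ∈ V, curveDegree Γ Z p ≤
          ∑ p ∈ V, (1 + curveDegree Γ Z p * (curveDegree Γ Z p - 1)) := by
        refine Finset.sum_le_sum fun p _ => ?_
        rcases curveDegree Γ Z p with _ | _ | x
        · simp
        · simp
        · simp only [Nat.add_sub_cancel]
          nlinarith
      rw [Finset.sum_add_distrib, Finset.sum_const, smul_eq_mul, mul_one] at h2
      have h3 := h2.trans (Nat.add_le_add_left (sum_curveDegree_pairs_le hD) _)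
      rw [hmdef, hndef]
      exact_mod_cast h3
    rw [e]
    refine h1.trans ?_
    have h2 : D * n ^ 2 ≤ 4 * D * Q := by
      rw [hQR]
      have : n ^ 2 ≤ 4 * (n * R₀) := by nlinarith
      nlinarith
    have h3 : m + 4 * D * Q ≤ (1 + 4 * D) * (Q + m + n) := by
      have : 0 ≤ D * (m + n) := by positivity
      linarith only [this, hQ0, hm, hn]
    have h4 : (1 + 4 * D) * (Q + m + n) ≤ CC * (Q + m + n) :=
      mul_le_mul_of_nonneg_right (by linarith only [hC₁0, hC₂1, hds, hk1, hCC])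
        (by linarith only [hQ0, hm, hn])
    linarith only [h2, h3, h4]
  push Not at hR2
  set R := ⌈R₀⌉₊ with hRdef
  have hRle : R₀ ≤ R := Nat.le_ceil _
  have hRlt : (R : ℝ) < R₀ + 1 := Nat.ceil_lt_add_one hR₀0.le
  have hR : 1 ≤ R := Nat.one_le_iff_ne_zero.2 (Nat.ceil_pos.2 hR₀0).ne'
  have hR' : (1 : ℝ) ≤ R := by exact_mod_cast hR
  have hRn : 2 * R ≤ Γ.card := by
    have : (2 : ℝ) * R ≤ n := by linarith
    rw [hndef] at this
    exact_mod_cast this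
  set w : ℝ := (n / R) ^ ((1 : ℝ) / k) with hw
  have hnR : 1 ≤ n / R := by
    rw [le_div_iff₀ (by positivity)]
    linarith
  have hw1 : 1 ≤ w := Real.one_le_rpow hnR (by positivity)
  have hwk : w ^ k = n / R := by
    rw [hw, ← Real.rpow_natCast, ← Real.rpow_mul (by positivity), one_div,
      inv_mul_cancel₀ (by positivity), Real.rpow_one]
  have h1 := sum_curveDegree_le_of_sample hk h𝒟 hD hs hR hRn hw1 hwk
  rw [e]
  have h2 : m * w ^ (k - 1) ≤ Q := by
    rw [hQR]
    refine le_of_pow_le_pow_left₀ (by omega : k ≠ 0) (by positivity) ?_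
    calc (m * w ^ (k - 1)) ^ k = m ^ k * (n / R) ^ (k - 1) := by
          rw [mul_pow, ← pow_mul, mul_comm (k - 1) k, pow_mul, hwk]
      _ ≤ m ^ k * (n / R₀) ^ (k - 1) := by gcongr
      _ = (n * R₀) ^ k := by
          rw [← hR₀p, div_pow]
          obtain ⟨j, rfl⟩ : ∃ j, k = j + 1 := ⟨k - 1, by omega⟩
          rw [show 2 * (j + 1) - 1 = 2 * j + 1 by omega, Nat.add_sub_cancel]
          field_simp
          ring
  have h3 : n * R ≤ 2 * Q := by
    rw [hQR]
    nlinarith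
  have h4 : C₁ * (n * R) ≤ C₁ * (2 * Q) := mul_le_mul_of_nonneg_left h3 hC₁0
  have h5 : C₂ * (m * w ^ (k - 1)) ≤ C₂ * Q := mul_le_mul_of_nonneg_left h2 (by linarith)
  have h6 : (2 * C₁ + C₂) * Q ≤ CC * (Q + m + n) :=
    mul_le_mul (by linarith only [hds, hk1, hDn, hCC]) (by linarith only [hm, hn])
      hQ0 hCC0
  linarith only [h1, h4, h5, h6]

end IncidenceCounting

section PlanarCells

open Finset
open scoped Classical

/-- A presentation of a plane set, away from finitely many vertical lines, as a stack of graphs of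
continuous functions. -/
structure CurveStack (Z : Set (ℝ × ℝ)) where
  exceptional : Finset ℝ
  height : ℝ → ℕ
  branch : ℕ → ℝ → ℝ
  mem_iff : ∀ x ∉ exceptional, ∀ y, (x, y) ∈ Z ↔ ∃ j < height x, branch j x = y
  branch_inj : ∀ x ∉ exceptional, ∀ i < height x, ∀ j < height x,
    branch i x = branch j x → i = j
  height_eq : ∀ x x', (∀ z ∈ Set.uIcc x x', z ∉ exceptional) → height x = height x'
  continuousOn : ∀ x x', (∀ z ∈ Set.uIcc x x', z ∉ exceptional) → ∀ j < height x,
    ContinuousOn (branch j) (Set.uIcc x x')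

namespace CurveStack

variable {ι : Type*} {Z : ι → Set (ℝ × ℝ)} (A : ∀ γ, CurveStack (Z γ)) (X : ι → ι → Finset ℝ)

/-- The abscissas of the vertical walls that `γ` contributes to cells bounded by the arc `a`. -/
noncomputable def wall (a : Option (ι × ℕ)) (γ : ι) : Finset ℝ :=
  (A γ).exceptional ∪ a.elim ∅ fun c => if c.1 = γ then ∅ else X c.1 γ

/-- The abscissas of the vertical walls of cells bounded by the arc `a`. -/
noncomputable def walls (S : Finset ι) (a : Option (ι × ℕ)) : Finset ℝ :=
  S.biUnion (wall A X a)

/-- The arc `c` lies weakly above `p` (for `σ = 1`), or weakly below `p` (for `σ = -1`). -/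
def Reaches (σ : ℝ) (S : Finset ι) (p : ℝ × ℝ) (c : ι × ℕ) : Prop :=
  c.1 ∈ S ∧ c.2 < (A c.1).height p.1 ∧ σ * p.2 ≤ σ * (A c.1).branch c.2 p.1

/-- The arc `a` is the first one met when moving up (or down) from `p`. -/
def IsFirst (σ : ℝ) (S : Finset ι) (p : ℝ × ℝ) (a : Option (ι × ℕ)) : Prop :=
  (∀ c ∈ a, Reaches A σ S p c) ∧ ∀ c, Reaches A σ S p c →
    ∃ c' ∈ a, c = c' ∨ σ * (A c'.1).branch c'.2 p.1 < σ * (A c.1).branch c.2 p.1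

variable {A X}

lemma mem_walls {S : Finset ι} {a : Option (ι × ℕ)} {x : ℝ} :
    x ∈ walls A X S a ↔ ∃ γ ∈ S, x ∈ (A γ).exceptional ∨ ∃ c ∈ a, c.1 ≠ γ ∧ x ∈ X c.1 γ := by
  simp only [walls, mem_biUnion, wall, mem_union]
  refine exists_congr fun γ => and_congr_right fun _ => or_congr_right ?_
  cases a with
  | none => simp
  | some c => by_cases h : c.1 = γ <;> simp [h]

lemma IsFirst.unique {σ : ℝ} {S : Finset ι} {p : ℝ × ℝ} {a b : Option (ι × ℕ)}
    (ha : IsFirst A σ S p a) (hb : IsFirst A σ S p b) : a = b := by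
  cases a with
  | none =>
    cases b with
    | none => rfl
    | some b =>
      obtain ⟨c, hc, -⟩ := ha.2 b (hb.1 b rfl)
      simp at hc
  | some a =>
    obtain ⟨c, hc, h⟩ := hb.2 a (ha.1 a rfl)
    obtain ⟨c', hc', h'⟩ := ha.2 c (hb.1 c hc)
    obtain rfl : a = c' := by simpa using hc'
    rcases h with rfl | h
    · exact hc.symm
    · rcases h' with rfl | h'
      · exact hc.symm
      · exact absurd h h'.not_gt

lemma IsFirst.mono {σ : ℝ} {S T : Finset ι} {p : ℝ × ℝ} {a : Option (ι × ℕ)} (hTS : T ⊆ S)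
    (ha : IsFirst A σ S p a) (haT : ∀ c ∈ a, c.1 ∈ T) : IsFirst A σ T p a :=
  ⟨fun c hc => ⟨haT c hc, (ha.1 c hc).2⟩, fun c hc => ha.2 c ⟨hTS hc.1, hc.2⟩⟩

/-- No two members of `S` meet on the vertical line through `p`, and the line is not exceptional
for any of them. -/
def IsGeneric (A : ∀ γ, CurveStack (Z γ)) (X : ι → ι → Finset ℝ) (S : Finset ι) (x : ℝ) : Prop :=
  (∀ γ ∈ S, x ∉ (A γ).exceptional) ∧ ∀ α ∈ S, ∀ β ∈ S, α ≠ β → x ∉ X α β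

lemma IsGeneric.notMem_walls {S : Finset ι} {x : ℝ} (h : IsGeneric A X S x)
    {a : Option (ι × ℕ)} (ha : ∀ c ∈ a, c.1 ∈ S) : x ∉ walls A X S a := by
  rw [mem_walls]
  rintro ⟨γ, hγ, h' | ⟨c, hc, hne, h'⟩⟩
  · exact h.1 γ hγ h'
  · exact h.2 _ (ha c hc) _ hγ hne h'

lemma branch_mem {γ : ι} {x : ℝ} (hx : x ∉ (A γ).exceptional) {j : ℕ}
    (hj : j < (A γ).height x) : (x, (A γ).branch j x) ∈ Z γ :=
  ((A γ).mem_iff x hx _).2 ⟨j, hj, rfl⟩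

lemma branch_ne {S : Finset ι}
    (hX : ∀ α ∈ S, ∀ β ∈ S, α ≠ β → ∀ z, z ∈ Z α → z ∈ Z β → z.1 ∈ X α β)
    {a c : ι × ℕ} (ha : a.1 ∈ S) (hc : c.1 ∈ S) (hne : c ≠ a) {x : ℝ}
    (hx : x ∉ walls A X S (some a)) (haN : a.2 < (A a.1).height x)
    (hcN : c.2 < (A c.1).height x) : (A a.1).branch a.2 x ≠ (A c.1).branch c.2 x := by
  have hE : ∀ γ ∈ S, x ∉ (A γ).exceptional := fun γ hγ h => hx (mem_walls.2 ⟨γ, hγ, Or.inl h⟩)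
  intro h
  by_cases hac : a.1 = c.1
  · obtain ⟨a1, a2⟩ := a
    obtain ⟨c1, c2⟩ := c
    obtain rfl : a1 = c1 := hac
    have := (A a1).branch_inj x (hE _ ha) _ haN _ hcN h
    simp_all
  · refine hx (mem_walls.2 ⟨c.1, hc, Or.inr ⟨a, rfl, hac, ?_⟩⟩)
    have h1 := branch_mem (hE _ ha) haN
    rw [h] at h1
    exact hX _ ha _ hc hac _ h1 (branch_mem (hE _ hc) hcN)

lemma IsGeneric.exists_isFirst {S : Finset ι} {p : ℝ × ℝ} (h : IsGeneric A X S p.1)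
    (hX : ∀ α ∈ S, ∀ β ∈ S, α ≠ β → ∀ z, z ∈ Z α → z ∈ Z β → z.1 ∈ X α β)
    {σ : ℝ} (hσ : σ ≠ 0) : ∃ a, IsFirst A σ S p a := by
  set F : Finset (ι × ℕ) := (S.biUnion fun γ =>
    (range ((A γ).height p.1)).image fun j => (γ, j)).filter (Reaches A σ S p) with hF
  have hmem : ∀ c, c ∈ F ↔ Reaches A σ S p c := by
    intro c
    simp only [hF, mem_filter, mem_biUnion, mem_image, mem_range, and_iff_right_iff_imp]
    exact fun hc => ⟨c.1, hc.1, c.2, hc.2.1, rfl⟩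
  rcases F.eq_empty_or_nonempty with hE | hE
  · refine ⟨none, by simp, fun c hc => ?_⟩
    rw [← hmem, hE] at hc
    simp at hc
  · obtain ⟨a, ha, hmin⟩ := F.exists_min_image
      (fun c => σ * (A c.1).branch c.2 p.1) hE
    rw [hmem] at ha
    refine ⟨some a, fun c hc => ?_, fun c hc => ⟨a, rfl, ?_⟩⟩
    · obtain rfl : a = c := by simpa using hc
      exact ha
    · by_cases hca : c = a
      · exact Or.inl hca
      · refine Or.inr (lt_of_le_of_ne (hmin c ((hmem c).2 hc)) fun he => ?_)
        refine branch_ne hX ha.1 hc.1 hca (h.notMem_walls ?_) ha.2.1 hc.2.1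
          (mul_left_cancel₀ hσ he)
        rintro c' hc'
        obtain rfl : a = c' := by simpa using hc'
        exact ha.1

lemma notMem_exceptional_of_walls {S : Finset ι} {a : Option (ι × ℕ)} {x x' : ℝ}
    (hw : ∀ w ∈ walls A X S a, w ∉ Set.uIcc x x') {γ : ι} (hγ : γ ∈ S) :
    ∀ z ∈ Set.uIcc x x', z ∉ (A γ).exceptional :=
  fun z hz h => hw z (mem_walls.2 ⟨γ, hγ, Or.inl h⟩) hz

/-- Away from walls, the order of two arcs does not change. -/
lemma branch_lt_of_walls {S : Finset ι}
    (hX : ∀ α ∈ S, ∀ β ∈ S, α ≠ β → ∀ z, z ∈ Z α → z ∈ Z β → z.1 ∈ X α β)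
    {a c : ι × ℕ} (ha : a.1 ∈ S) (hc : c.1 ∈ S) {x x' : ℝ}
    (hw : ∀ w ∈ walls A X S (some a), w ∉ Set.uIcc x x') (haN : a.2 < (A a.1).height x)
    (hcN : c.2 < (A c.1).height x) {σ : ℝ}
    (hlt : σ * (A a.1).branch a.2 x < σ * (A c.1).branch c.2 x) :
    σ * (A a.1).branch a.2 x' < σ * (A c.1).branch c.2 x' := by
  have hσ : σ ≠ 0 := by rintro rfl; simp at hlt
  have hne : c ≠ a := by rintro rfl; exact hlt.false
  have hEa := notMem_exceptional_of_walls hw ha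
  have hEc := notMem_exceptional_of_walls hw hc
  by_contra! hle
  set f : ℝ → ℝ := fun z => σ * (A c.1).branch c.2 z - σ * (A a.1).branch a.2 z with hf
  have hfc : ContinuousOn f (Set.uIcc x x') :=
    (((A c.1).continuousOn x x' hEc _ hcN).const_smul σ).sub
      (((A a.1).continuousOn x x' hEa _ haN).const_smul σ)
  have h0 : (0 : ℝ) ∈ Set.uIcc (f x) (f x') :=
    Set.mem_uIcc.2 (Or.inr ⟨by simpa [hf] using hle, by simpa [hf] using hlt.le⟩)
  obtain ⟨z, hz, hz0⟩ := intermediate_value_uIcc hfc h0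
  have hsub : Set.uIcc x z ⊆ Set.uIcc x x' := Set.uIcc_subset_uIcc Set.left_mem_uIcc hz
  have ea := (A a.1).height_eq x z fun y hy => hEa y (hsub hy)
  have ec := (A c.1).height_eq x z fun y hy => hEc y (hsub hy)
  refine branch_ne hX ha hc hne (fun h => hw z h hz) (ea ▸ haN) (ec ▸ hcN)
    (mul_left_cancel₀ hσ (by simp only [hf] at hz0; linarith))

lemma IsFirst.transfer {S : Finset ι}
    (hX : ∀ α ∈ S, ∀ β ∈ S, α ≠ β → ∀ z, z ∈ Z α → z ∈ Z β → z.1 ∈ X α β)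
    {σ : ℝ} {p q : ℝ × ℝ} {a b : Option (ι × ℕ)} (hpa : IsFirst A σ S p a)
    (hpb : IsFirst A (-σ) S p b) (hwa : ∀ w ∈ walls A X S a, w ∉ Set.uIcc p.1 q.1)
    (hwb : ∀ w ∈ walls A X S b, w ∉ Set.uIcc p.1 q.1)
    (hqa : ∀ c ∈ a, Reaches A σ S q c) (hqb : ∀ c ∈ b, Reaches A (-σ) S q c)
    (hb : ∀ c ∈ b, Reaches A σ S q c →
      ∃ c' ∈ a, c = c' ∨ σ * (A c'.1).branch c'.2 q.1 < σ * (A c.1).branch c.2 q.1) :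
    IsFirst A σ S q a := by
  refine ⟨hqa, fun c hc => ?_⟩
  have hE := notMem_exceptional_of_walls hwa hc.1
  have hcN : c.2 < (A c.1).height p.1 := by
    rw [(A c.1).height_eq _ _ hE]
    exact hc.2.1
  by_cases hcp : σ * p.2 ≤ σ * (A c.1).branch c.2 p.1
  · obtain ⟨c', hc', h⟩ := hpa.2 c ⟨hc.1, hcN, hcp⟩
    refine ⟨c', hc', h.imp_right fun h => ?_⟩
    obtain rfl : a = some c' := hc'
    exact branch_lt_of_walls hX (hqa c' rfl).1 hc.1 hwa (hpa.1 c' rfl).2.1 hcN h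
  · push Not at hcp
    obtain ⟨c', hc', h⟩ := hpb.2 c ⟨hc.1, hcN, by linarith⟩
    rcases h with rfl | h
    · exact hb c hc' hc
    · obtain rfl : b = some c' := hc'
      have h1 := branch_lt_of_walls hX (hqb c' rfl).1 hc.1 hwb (hpb.1 c' rfl).2.1 hcN h
      have h2 := (hqb c' rfl).2.2
      have h3 := hc.2.2
      linarith

lemma IsFirst.eq_of_mem {S : Finset ι} {σ : ℝ} {p : ℝ × ℝ} {a b : Option (ι × ℕ)}
    (hb : IsFirst A (-σ) S p b) {c : ι × ℕ} (hc : Reaches A σ S p c)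
    (hc' : Reaches A (-σ) S p c) (hca : c ∈ a) : a = b := by
  obtain ⟨e, he, rfl | h⟩ := hb.2 c hc'
  · obtain rfl : a = some c := hca
    exact he.symm
  · have h1 := (hb.1 e he).2.2
    have h2 := hc.2.2
    linarith

/-- Points with the same first arc on one side, not separated by walls, have the same first arc on
the other side. -/
lemma IsFirst.opposite {S : Finset ι}
    (hX : ∀ α ∈ S, ∀ β ∈ S, α ≠ β → ∀ z, z ∈ Z α → z ∈ Z β → z.1 ∈ X α β)
    {σ : ℝ} {p q : ℝ × ℝ} {a b b' : Option (ι × ℕ)} (hpa : IsFirst A σ S p a)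
    (hpb : IsFirst A (-σ) S p b) (hqa : IsFirst A σ S q a) (hqb : IsFirst A (-σ) S q b')
    (hwa : ∀ w ∈ walls A X S a, w ∉ Set.uIcc p.1 q.1)
    (hwb : ∀ w ∈ walls A X S b, w ∉ Set.uIcc p.1 q.1) (hbb : a = b ↔ a = b') : b = b' := by
  by_cases hab : a = b
  · rw [← hab, hbb.1 hab]
  have hab' : a ≠ b' := fun h => hab (hbb.2 h)
  have key : ∀ c ∈ b, Reaches A (-σ) S q c := by
    intro c hc
    have hc1 := hpb.1 c hc
    have hcN : c.2 < (A c.1).height q.1 := by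
      rw [← (A c.1).height_eq p.1 q.1 (notMem_exceptional_of_walls hwa hc1.1)]
      exact hc1.2.1
    refine ⟨hc1.1, hcN, ?_⟩
    by_contra! hlt
    obtain ⟨c', hc', rfl | h⟩ := hqa.2 c ⟨hc1.1, hcN, by linarith⟩
    · refine hab ?_
      obtain rfl : a = some c := hc'
      exact (show b = some c from hc).symm
    · obtain rfl : a = some c' := hc'
      rw [Set.uIcc_comm] at hwa
      have h1 := branch_lt_of_walls hX (hqa.1 c' rfl).1 hc1.1 hwa (hqa.1 c' rfl).2.1 hcN h
      have h2 := hc1.2.2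
      have h3 := (hpa.1 c' rfl).2.2
      linarith
  refine IsFirst.unique (IsFirst.transfer hX hpb (b := a) (by simpa using hpa) hwb hwa key
    (by simpa using hqa.1) fun c hc hcq => ?_) hqb
  exact absurd (hqb.eq_of_mem (hqa.1 c hc) hcq hc) hab'

/-- Two points lie in the same cell of the vertical decomposition induced by `S`. -/
def SameCell (A : ∀ γ, CurveStack (Z γ)) (X : ι → ι → Finset ℝ) (S : Finset ι)
    (p q : ℝ × ℝ) : Prop :=
  p = q ∨ ∃ a b, (IsFirst A 1 S p a ∧ IsFirst A (-1) S p b) ∧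
    (IsFirst A 1 S q a ∧ IsFirst A (-1) S q b) ∧
    (∀ w ∈ walls A X S a, w ∉ Set.uIcc p.1 q.1) ∧ ∀ w ∈ walls A X S b, w ∉ Set.uIcc p.1 q.1

lemma SameCell.symm {S : Finset ι} {p q : ℝ × ℝ} (h : SameCell A X S p q) :
    SameCell A X S q p := by
  rcases h with rfl | ⟨a, b, hp, hq, ha, hb⟩
  · exact Or.inl rfl
  · rw [Set.uIcc_comm] at ha hb
    exact Or.inr ⟨a, b, hq, hp, ha, hb⟩

lemma SameCell.trans {S : Finset ι} {p q r : ℝ × ℝ} (h : SameCell A X S p q)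
    (h' : SameCell A X S q r) : SameCell A X S p r := by
  rcases h with rfl | ⟨a, b, hp, hq, ha, hb⟩
  · exact h'
  rcases h' with rfl | ⟨a', b', hq', hr, ha', hb'⟩
  · exact Or.inr ⟨a, b, hp, hq, ha, hb⟩
  obtain rfl := hq.1.unique hq'.1
  obtain rfl := hq.2.unique hq'.2
  refine Or.inr ⟨a, b, hp, hr, fun w hw h => ?_, fun w hw h => ?_⟩
  · rcases Set.uIcc_subset_uIcc_union_uIcc (b := q.1) h with h | h
    exacts [ha w hw h, ha' w hw h]
  · rcases Set.uIcc_subset_uIcc_union_uIcc (b := q.1) h with h | h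
    exacts [hb w hw h, hb' w hw h]

lemma SameCell.mem_curve {S : Finset ι} {p q : ℝ × ℝ} (h : SameCell A X S p q) {γ : ι}
    (hγ : γ ∈ S) (hp : p ∈ Z γ) : q ∈ Z γ := by
  rcases h with rfl | ⟨a, b, hpab, hqab, ha, hb⟩
  · exact hp
  have hE := notMem_exceptional_of_walls ha hγ
  obtain ⟨j, hj, hjp⟩ := ((A γ).mem_iff p.1 (hE _ Set.left_mem_uIcc) p.2).1 hp
  obtain ⟨c, hc, h⟩ := hpab.1.2 (γ, j) ⟨hγ, hj, by simp [hjp]⟩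
  obtain ⟨e, he, h'⟩ := hpab.2.2 (γ, j) ⟨hγ, hj, by simp [hjp]⟩
  have h1 := (hpab.1.1 c hc).2.2
  have h2 := (hpab.2.1 e he).2.2
  obtain rfl : (γ, j) = c := h.resolve_right (by simp only [hjp]; linarith)
  obtain rfl : (γ, j) = e := h'.resolve_right (by simp only [hjp]; linarith)
  have h3 := hqab.1.1 _ hc
  have h4 := (hqab.2.1 _ he).2.2
  refine ((A γ).mem_iff q.1 (hE _ Set.right_mem_uIcc) q.2).2 ⟨j, h3.2.1, ?_⟩
  have h5 := h3.2.2
  simp only at h4 h5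
  linarith

lemma SameCell.isGeneric {S : Finset ι} {p q : ℝ × ℝ} (h : SameCell A X S p q) (hpq : p ≠ q)
    (hG : ∀ α ∈ S, ∀ β ∈ S, α ≠ β → p.1 ∈ X α β → p ∈ Z α ∧ p ∈ Z β) :
    IsGeneric A X S p.1 := by
  rcases h with rfl | ⟨a, b, hpab, hqab, ha, hb⟩
  · exact absurd rfl hpq
  have hE : ∀ γ ∈ S, p.1 ∉ (A γ).exceptional :=
    fun γ hγ => notMem_exceptional_of_walls ha hγ _ Set.left_mem_uIcc
  refine ⟨hE, fun α hα β hβ hne hx => ?_⟩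
  have key : ∀ γ ∈ S, p ∈ Z γ → ∃ c ∈ a, c.1 = γ := by
    intro γ hγ hp
    obtain ⟨j, hj, hjp⟩ := ((A γ).mem_iff p.1 (hE γ hγ) p.2).1 hp
    obtain ⟨c, hc, h⟩ := hpab.1.2 (γ, j) ⟨hγ, hj, by simp [hjp]⟩
    have h1 := (hpab.1.1 c hc).2.2
    obtain rfl : (γ, j) = c := h.resolve_right (by simp only [hjp]; linarith)
    exact ⟨_, hc, rfl⟩
  obtain ⟨c, hc, rfl⟩ := key α hα (hG α hα β hβ hne hx).1
  obtain ⟨e, he, rfl⟩ := key β hβ (hG _ hα _ hβ hne hx).2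
  obtain rfl : a = some c := hc
  obtain rfl : c = e := by simpa using he
  exact hne rfl

lemma exists_first_owner {R : Type*} [LinearOrder R] (S : Finset ι) (f : ι → Finset R) (x : R) :
    ∃ D : Finset ι, D.card ≤ 1 ∧ ∀ γ ∈ S, γ ∉ D → ∀ x',
      (∀ γ' ∈ S.erase γ, ∀ w ∈ f γ', ¬ (x ≤ w ∧ w ≤ x')) →
        ∀ γ' ∈ S, ∀ w ∈ f γ', ¬ (x ≤ w ∧ w ≤ x') := by
  set W := (S.biUnion f).filter (x ≤ ·) with hW
  have hmem : ∀ γ ∈ S, ∀ w ∈ f γ, x ≤ w → w ∈ W := fun γ hγ w hw hx =>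
    mem_filter.2 ⟨mem_biUnion.2 ⟨γ, hγ, hw⟩, hx⟩
  rcases W.eq_empty_or_nonempty with h | h
  · refine ⟨∅, by simp, fun γ _ _ x' _ γ' hγ' w hw hx => ?_⟩
    have := hmem γ' hγ' w hw hx.1
    simp [h] at this
  · obtain ⟨w₀, hw₀, hmin⟩ := W.exists_min_image id h
    obtain ⟨h₁, hx₀⟩ := mem_filter.1 hw₀
    obtain ⟨γ₀, hγ₀, hf⟩ := mem_biUnion.1 h₁
    refine ⟨{γ₀}, by simp, fun γ hγ hne x' hx' γ' hγ' w hw hx => ?_⟩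
    have hne' : γ₀ ≠ γ := fun h => hne (by simp [h])
    exact hx' γ₀ (mem_erase.2 ⟨hne', hγ₀⟩) w₀ hf
      ⟨hx₀, (hmin w (hmem γ' hγ' w hw hx.1)).trans hx.2⟩

lemma sameCell_iff_eq {S : Finset ι} {p q : ℝ × ℝ} (h : ¬ IsGeneric A X S p.1)
    (hG : ∀ α ∈ S, ∀ β ∈ S, α ≠ β → p.1 ∈ X α β → p ∈ Z α ∧ p ∈ Z β) :
    SameCell A X S p q ↔ p = q := by
  refine ⟨fun hpq => ?_, Or.inl⟩
  by_contra hne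
  exact h (hpq.isGeneric hne hG)

lemma exists_defining_of_not_isGeneric {S : Finset ι} {x : ℝ} (h : ¬ IsGeneric A X S x) :
    ∃ D : Finset ι, D.card ≤ 2 ∧ ∀ γ ∉ D, ¬ IsGeneric A X (S.erase γ) x := by
  by_cases h1 : ∀ γ ∈ S, x ∉ (A γ).exceptional
  · have h2 : ∃ α ∈ S, ∃ β ∈ S, α ≠ β ∧ x ∈ X α β := by
      by_contra! h2
      exact h ⟨h1, h2⟩
    obtain ⟨α, hα, β, hβ, hne, hx⟩ := h2
    refine ⟨{α, β}, card_le_two, fun γ hγ hg => ?_⟩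
    simp only [mem_insert, mem_singleton, not_or] at hγ
    exact hg.2 α (mem_erase.2 ⟨Ne.symm hγ.1, hα⟩) β (mem_erase.2 ⟨Ne.symm hγ.2, hβ⟩) hne hx
  · push Not at h1
    obtain ⟨α, hα, hx⟩ := h1
    refine ⟨{α}, by simp, fun γ hγ hg => ?_⟩
    simp only [mem_singleton] at hγ
    exact hg.1 α (mem_erase.2 ⟨Ne.symm hγ, hα⟩) hx

lemma IsGeneric.mono {S T : Finset ι} {x : ℝ} (h : IsGeneric A X S x) (hTS : T ⊆ S) :
    IsGeneric A X T x :=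
  ⟨fun γ hγ => h.1 γ (hTS hγ), fun α hα β hβ => h.2 α (hTS hα) β (hTS hβ)⟩

lemma walls_mono {S T : Finset ι} (hTS : T ⊆ S) (a : Option (ι × ℕ)) :
    walls A X T a ⊆ walls A X S a :=
  biUnion_subset_biUnion_of_subset_left _ hTS

/-- A cell is determined by at most four curves. -/
lemma exists_defining_sameCell {S : Finset ι}
    (hX : ∀ α ∈ S, ∀ β ∈ S, α ≠ β → ∀ z, z ∈ Z α → z ∈ Z β → z.1 ∈ X α β) {p : ℝ × ℝ}
    (hG : ∀ α ∈ S, ∀ β ∈ S, α ≠ β → p.1 ∈ X α β → p ∈ Z α ∧ p ∈ Z β) :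
    ∃ D : Finset ι, D.card ≤ 4 ∧ ∀ γ ∈ S, γ ∉ D → ∀ q,
      (SameCell A X (S.erase γ) p q ↔ SameCell A X S p q) := by
  by_cases hgen : IsGeneric A X S p.1
  swap
  · obtain ⟨D, hD, h⟩ := exists_defining_of_not_isGeneric hgen
    refine ⟨D, by omega, fun γ _ hγD q => ?_⟩
    rw [sameCell_iff_eq hgen hG, sameCell_iff_eq (h γ hγD)]
    exact fun α hα β hβ => hG α (mem_of_mem_erase hα) β (mem_of_mem_erase hβ)
  obtain ⟨a, ha⟩ := hgen.exists_isFirst hX one_ne_zero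
  obtain ⟨b, hb⟩ := hgen.exists_isFirst hX (neg_ne_zero.2 one_ne_zero)
  obtain ⟨D₁, hD₁, h₁⟩ := exists_first_owner S (fun γ => wall A X a γ ∪ wall A X b γ) p.1
  obtain ⟨D₂, hD₂, h₂⟩ := exists_first_owner (R := ℝᵒᵈ) S
    (fun γ => wall A X a γ ∪ wall A X b γ) p.1
  have hao : ∀ a : Option (ι × ℕ), (a.toFinset.image Prod.fst).card ≤ 1 := fun a =>
    card_image_le.trans (by cases a <;> simp)
  refine ⟨a.toFinset.image Prod.fst ∪ b.toFinset.image Prod.fst ∪ (D₁ ∪ D₂), ?_, ?_⟩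
  · have e1 := card_union_le (a.toFinset.image Prod.fst ∪ b.toFinset.image Prod.fst) (D₁ ∪ D₂)
    have e2 := card_union_le (a.toFinset.image Prod.fst) (b.toFinset.image Prod.fst)
    have e3 := card_union_le D₁ D₂
    have e4 := hao a
    have e5 := hao b
    omega
  intro γ hγ hγD q
  simp only [mem_union, mem_image, Option.mem_toFinset, not_or, not_exists, not_and] at hγD
  obtain ⟨⟨hγa, hγb⟩, hγ₁, hγ₂⟩ := hγD
  have hTS : S.erase γ ⊆ S := erase_subset _ _
  have haT : ∀ c ∈ a, c.1 ∈ S.erase γ := fun c hc => mem_erase.2 ⟨hγa c hc, (ha.1 c hc).1⟩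
  have hbT : ∀ c ∈ b, c.1 ∈ S.erase γ := fun c hc => mem_erase.2 ⟨hγb c hc, (hb.1 c hc).1⟩
  constructor
  · rintro (rfl | ⟨a', b', hp, hq, hwa, hwb⟩)
    · exact Or.inl rfl
    obtain rfl := (ha.mono hTS haT).unique hp.1
    obtain rfl := (hb.mono hTS hbT).unique hp.2
    have hw : ∀ γ' ∈ S, ∀ w ∈ wall A X a γ' ∪ wall A X b γ', w ∉ Set.uIcc p.1 q.1 := by
      have hw' : ∀ γ' ∈ S.erase γ, ∀ w ∈ wall A X a γ' ∪ wall A X b γ',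
          w ∉ Set.uIcc p.1 q.1 := by
        intro γ' hγ' w hw
        rcases mem_union.1 hw with hw | hw
        · exact hwa w (mem_biUnion.2 ⟨γ', hγ', hw⟩)
        · exact hwb w (mem_biUnion.2 ⟨γ', hγ', hw⟩)
      rcases le_total p.1 q.1 with hpq | hpq
      · rw [Set.uIcc_of_le hpq] at hw' ⊢
        exact h₁ γ hγ hγ₁ q.1 hw'
      · rw [Set.uIcc_of_ge hpq] at hw' ⊢
        exact fun γ' hγ' w hw hwm => h₂ γ hγ hγ₂ q.1
          (fun γ'' hγ'' v hv hvm => hw' γ'' hγ'' v hv ⟨hvm.2, hvm.1⟩) γ' hγ' w hw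
          ⟨hwm.2, hwm.1⟩
    have hwaS : ∀ w ∈ walls A X S a, w ∉ Set.uIcc p.1 q.1 := by
      intro w hwm
      obtain ⟨γ', hγ', h⟩ := mem_biUnion.1 hwm
      exact hw γ' hγ' w (mem_union_left _ h)
    have hwbS : ∀ w ∈ walls A X S b, w ∉ Set.uIcc p.1 q.1 := by
      intro w hwm
      obtain ⟨γ', hγ', h⟩ := mem_biUnion.1 hwm
      exact hw γ' hγ' w (mem_union_right _ h)
    have hqa : ∀ c ∈ a, Reaches A 1 S q c := fun c hc =>
      ⟨hTS (haT c hc), (hq.1.1 c hc).2⟩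
    have hqb : ∀ c ∈ b, Reaches A (-1) S q c := fun c hc =>
      ⟨hTS (hbT c hc), (hq.2.1 c hc).2⟩
    refine Or.inr ⟨a, b, ⟨ha, hb⟩, ⟨?_, ?_⟩, hwaS, hwbS⟩
    · exact ha.transfer hX hb hwaS hwbS hqa hqb fun c hc hcq => hq.1.2 c ⟨hbT c hc, hcq.2⟩
    · exact hb.transfer hX (by simpa using ha) hwbS hwaS hqb (by simpa using hqa)
        fun c hc hcq => hq.2.2 c ⟨haT c hc, hcq.2⟩
  · rintro (rfl | ⟨a', b', hp, hq, hwa, hwb⟩)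
    · exact Or.inl rfl
    obtain rfl := ha.unique hp.1
    obtain rfl := hb.unique hp.2
    exact Or.inr ⟨a, b, ⟨ha.mono hTS haT, hb.mono hTS hbT⟩,
      ⟨hq.1.mono hTS haT, hq.2.mono hTS hbT⟩, fun w hw => hwa w (walls_mono hTS a hw),
      fun w hw => hwb w (walls_mono hTS b hw)⟩

/-- A cell with first arc `a` on the side `σ`, whose next wall to the right is a wall of `a`. -/
def IsLabel (A : ∀ γ, CurveStack (Z γ)) (X : ι → ι → Finset ℝ) (S : Finset ι) (σ : ℝ)
    (p : ℝ × ℝ) (a : Option (ι × ℕ)) (o : Option ℝ) (e : Prop) : Prop :=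
  ∃ b, IsFirst A σ S p a ∧ IsFirst A (-σ) S p b ∧ (a = b ↔ e) ∧
    (∀ w ∈ o, w ∈ walls A X S a ∧ p.1 < w) ∧
    ∀ v, v ∈ walls A X S a ∨ v ∈ walls A X S b → p.1 < v → ∃ w ∈ o, w ≤ v

lemma exists_next (W : Finset ℝ) (x : ℝ) :
    ∃ o : Option ℝ, (∀ w ∈ o, w ∈ W ∧ x < w) ∧ ∀ v ∈ W, x < v → ∃ w ∈ o, w ≤ v := by
  rcases (W.filter (x < ·)).eq_empty_or_nonempty with h | h
  · refine ⟨none, by simp, fun v hv hx => ?_⟩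
    have : v ∈ W.filter (x < ·) := mem_filter.2 ⟨hv, hx⟩
    simp [h] at this
  · obtain ⟨w, hw, hmin⟩ := (W.filter (x < ·)).exists_min_image id h
    refine ⟨some w, fun w' hw' => ?_, fun v hv hx => ⟨w, rfl, hmin v (mem_filter.2 ⟨hv, hx⟩)⟩⟩
    obtain rfl : w = w' := by simpa using hw'
    exact mem_filter.1 hw

lemma IsGeneric.exists_isLabel {S : Finset ι} {p : ℝ × ℝ} (h : IsGeneric A X S p.1)
    (hX : ∀ α ∈ S, ∀ β ∈ S, α ≠ β → ∀ z, z ∈ Z α → z ∈ Z β → z.1 ∈ X α β) :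
    ∃ a o e, IsLabel A X S 1 p a o e ∨ IsLabel A X S (-1) p a o e := by
  obtain ⟨a, ha⟩ := h.exists_isFirst hX one_ne_zero
  obtain ⟨b, hb⟩ := h.exists_isFirst hX (neg_ne_zero.2 one_ne_zero)
  obtain ⟨o, ho, ho'⟩ := exists_next (walls A X S a ∪ walls A X S b) p.1
  by_cases hoa : ∀ w ∈ o, w ∈ walls A X S a
  · exact ⟨a, o, _, Or.inl ⟨b, ha, hb, Iff.rfl, fun w hw => ⟨hoa w hw, (ho w hw).2⟩,
      fun v hv => ho' v (mem_union.2 hv)⟩⟩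
  · have hob : ∀ w ∈ o, w ∈ walls A X S b := by
      push Not at hoa
      obtain ⟨w, hw, hwa⟩ := hoa
      intro w' hw'
      obtain rfl : w = w' := Option.mem_unique hw hw'
      exact (mem_union.1 (ho w hw).1).resolve_left hwa
    exact ⟨b, o, _, Or.inr ⟨a, hb, by simpa using ha, Iff.rfl,
      fun w hw => ⟨hob w hw, (ho w hw).2⟩, fun v hv => ho' v (mem_union.2 hv.symm)⟩⟩

lemma IsLabel.sameCell {S : Finset ι}
    (hX : ∀ α ∈ S, ∀ β ∈ S, α ≠ β → ∀ z, z ∈ Z α → z ∈ Z β → z.1 ∈ X α β) {σ : ℝ}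
    (hσ : σ = 1 ∨ σ = -1) {p q : ℝ × ℝ} {a : Option (ι × ℕ)} {o : Option ℝ} {e : Prop}
    (hp : IsLabel A X S σ p a o e) (hq : IsLabel A X S σ q a o e)
    (hgp : IsGeneric A X S p.1) (hpq : p.1 ≤ q.1) : SameCell A X S p q := by
  obtain ⟨b, hpa, hpb, heb, hpo, hpo'⟩ := hp
  obtain ⟨b', hqa, hqb, heb', hqo, hqo'⟩ := hq
  have hw : ∀ v, v ∈ walls A X S a ∨ v ∈ walls A X S b → v ∉ Set.uIcc p.1 q.1 := by
    intro v hv hvm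
    rw [Set.uIcc_of_le hpq] at hvm
    have hne : p.1 ≠ v := by
      rintro rfl
      rcases hv with hv | hv
      · exact hgp.notMem_walls (fun c hc => (hpa.1 c hc).1) hv
      · exact hgp.notMem_walls (fun c hc => (hpb.1 c hc).1) hv
    obtain ⟨w, hw, hwv⟩ := hpo' v hv (lt_of_le_of_ne hvm.1 hne)
    exact ((hqo w hw).2.trans_le (hwv.trans hvm.2)).false
  have hwa := fun v hv => hw v (Or.inl hv)
  have hwb := fun v hv => hw v (Or.inr hv)
  obtain rfl := hpa.opposite hX hpb hqa hqb hwa hwb (heb.trans heb'.symm)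
  rcases hσ with rfl | rfl
  · exact Or.inr ⟨a, b, ⟨hpa, hpb⟩, ⟨hqa, hqb⟩, hwa, hwb⟩
  · rw [neg_neg] at hpb hqb
    exact Or.inr ⟨b, a, ⟨hpb, hpa⟩, ⟨hqb, hqa⟩, hwb, hwa⟩

lemma card_image_le_of_factor {α β R : Type*} [Nonempty α] [DecidableEq β] {f : α → β} {g : α → R}
    {s : Finset α} {t : Finset R} (hg : ∀ a ∈ s, g a ∈ t)
    (h : ∀ a ∈ s, ∀ b ∈ s, g a = g b → f a = f b) : (s.image f).card ≤ t.card := by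
  have hch : ∀ y ∈ s.image f, ∃ a ∈ s, f a = y := fun y hy => mem_image.1 hy
  choose! c hc using hch
  refine card_le_card_of_injOn (g ∘ c) (fun y hy => hg _ (hc y hy).1) fun y hy z hz hyz => ?_
  rw [← (hc y hy).2, ← (hc z hz).2]
  exact h _ (hc y hy).1 _ (hc z hz).1 hyz

lemma card_walls_le {S : Finset ι} {K₀ D : ℕ} (hK : ∀ γ ∈ S, (A γ).exceptional.card ≤ K₀)
    (hD : ∀ α ∈ S, ∀ β ∈ S, α ≠ β → (X α β).card ≤ D) {a : Option (ι × ℕ)}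
    (ha : ∀ c ∈ a, c.1 ∈ S) : (walls A X S a).card ≤ S.card * (K₀ + D) := by
  refine card_biUnion_le_card_mul _ _ _ fun γ hγ => (card_union_le _ _).trans ?_
  refine add_le_add (hK γ hγ) ?_
  cases a with
  | none => simp
  | some c =>
    by_cases h : c.1 = γ
    · simp [h]
    · simpa [h] using hD _ (ha c rfl) _ hγ h

lemma card_image_sameCell_le {S : Finset ι} {K₀ D d : ℕ}
    (hK : ∀ γ ∈ S, (A γ).exceptional.card ≤ K₀)
    (hd : ∀ γ ∈ S, ∀ x, (A γ).height x ≤ d)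
    (hD : ∀ α ∈ S, ∀ β ∈ S, α ≠ β → (X α β).card ≤ D)
    (hX : ∀ α ∈ S, ∀ β ∈ S, α ≠ β → ∀ z, z ∈ Z α → z ∈ Z β → z.1 ∈ X α β)
    {V : Finset (ℝ × ℝ)} (hV : ∀ p ∈ V, ∀ q ∈ V, p.1 = q.1 → p = q) {β : Type*} [DecidableEq β]
    {f : ℝ × ℝ → β} (hf : ∀ p ∈ V, ∀ q ∈ V, SameCell A X S p q → f p = f q) :
    (V.image f).card ≤ (K₀ + D + 4 * (d + 1) * (K₀ + D + 1)) * (S.card + 1) ^ 2 := by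
  set r := S.card with hr
  set G := V.filter fun p => IsGeneric A X S p.1 with hG
  set N := V.filter fun p => ¬ IsGeneric A X S p.1 with hN
  have hVGN : V = N ∪ G := by
    rw [union_comm]
    exact (filter_union_filter_not_eq _ V).symm
  have h1 : (N.image f).card ≤ r * K₀ + r * r * D := by
    have e1 : N.card = (N.image Prod.fst).card := by
      refine (card_image_of_injOn fun p hp q hq h => ?_).symm
      exact hV p (mem_filter.1 hp).1 q (mem_filter.1 hq).1 h
    have e2 : N.image Prod.fst ⊆ (S.biUnion fun γ => (A γ).exceptional) ∪
        ((S ×ˢ S).filter fun x => x.1 ≠ x.2).biUnion fun x => X x.1 x.2 := by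
      intro x hx
      obtain ⟨p, hp, rfl⟩ := mem_image.1 hx
      have hp' := (mem_filter.1 hp).2
      rw [IsGeneric, not_and_or] at hp'
      push Not at hp'
      rcases hp' with ⟨γ, hγ, h⟩ | ⟨α, hα, β, hβ, hne, h⟩
      · exact mem_union_left _ (mem_biUnion.2 ⟨γ, hγ, h⟩)
      · exact mem_union_right _ (mem_biUnion.2 ⟨(α, β),
          mem_filter.2 ⟨mem_product.2 ⟨hα, hβ⟩, hne⟩, h⟩)
    have e3 : (((S ×ˢ S).filter fun x => x.1 ≠ x.2).biUnion fun x => X x.1 x.2).card ≤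
        r * r * D := by
      refine (card_biUnion_le_card_mul _ _ D fun x hx => ?_).trans
        (Nat.mul_le_mul_right _ ((card_filter_le _ _).trans (card_product _ _).le))
      obtain ⟨hx, hne⟩ := mem_filter.1 hx
      exact hD _ (mem_product.1 hx).1 _ (mem_product.1 hx).2 hne
    calc (N.image f).card ≤ N.card := card_image_le
      _ ≤ _ := e1 ▸ card_le_card e2
      _ ≤ _ := card_union_le _ _
      _ ≤ _ := add_le_add (card_biUnion_le_card_mul _ _ _ hK) e3
  have h2 : (G.image f).card ≤ 4 * ((r * d + 1) * (r * (K₀ + D) + 1)) := by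
    set T : Finset (Option (ι × ℕ) × Option ℝ) :=
      (insertNone (S ×ˢ range d)).biUnion fun a =>
        (insertNone (walls A X S a)).image fun o => (a, o) with hT
    have hTc : T.card ≤ (r * d + 1) * (r * (K₀ + D) + 1) := by
      have : (insertNone (S ×ˢ range d)).card = r * d + 1 := by
        rw [card_insertNone, card_product, card_range]
      rw [← this]
      refine card_biUnion_le_card_mul _ _ _ fun a ha => card_image_le.trans ?_
      rw [card_insertNone]
      refine Nat.add_le_add_right (card_walls_le hK hD fun c hc => ?_) 1
      exact (mem_product.1 (mem_insertNone.1 ha c hc)).1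
    have hlab : ∀ p : ℝ × ℝ, ∃ l : ℝ × Prop × Option (ι × ℕ) × Option ℝ, p ∈ G →
        (l.1 = 1 ∨ l.1 = -1) ∧ IsLabel A X S l.1 p l.2.2.1 l.2.2.2 l.2.1 := by
      intro p
      by_cases hp : p ∈ G
      · obtain ⟨a, o, e, h | h⟩ := (mem_filter.1 hp).2.exists_isLabel hX
        · exact ⟨(1, e, a, o), fun _ => ⟨Or.inl rfl, h⟩⟩
        · exact ⟨(-1, e, a, o), fun _ => ⟨Or.inr rfl, h⟩⟩
      · exact ⟨(0, True, none, none), fun h => absurd h hp⟩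
    choose l hl using hlab
    refine (card_image_le_of_factor (g := l)
      (t := ({1, -1} : Finset ℝ) ×ˢ (Finset.univ : Finset Prop) ×ˢ T) (fun p hp => ?_)
      fun p hp q hq hpq => ?_).trans ?_
    · obtain ⟨h, b, ha, -, -, ho, -⟩ := hl p hp
      refine mem_product.2 ⟨by simpa using h, mem_product.2 ⟨mem_univ _, ?_⟩⟩
      refine mem_biUnion.2 ⟨(l p).2.2.1, mem_insertNone.2 fun c hc => ?_,
        mem_image.2 ⟨(l p).2.2.2, mem_insertNone.2 fun w hw => (ho w hw).1, rfl⟩⟩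
      have := ha.1 c hc
      exact mem_product.2 ⟨this.1, mem_range.2 (this.2.1.trans_le (hd _ this.1 _))⟩
    · have hp' := hl p hp
      have hq' := hl q hq
      rw [← hpq] at hq'
      obtain ⟨hpV, hpg⟩ := mem_filter.1 hp
      obtain ⟨hqV, hqg⟩ := mem_filter.1 hq
      rcases le_total p.1 q.1 with h | h
      · exact hf p hpV q hqV (hp'.2.sameCell hX hp'.1 hq'.2 hpg h)
      · exact (hf q hqV p hpV (hq'.2.sameCell hX hp'.1 hp'.2 hqg h)).symm
    · rw [card_product, card_product]
      have e1 : ({1, -1} : Finset ℝ).card ≤ 2 := card_le_two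
      have e2 : (Finset.univ : Finset Prop).card = 2 := by simp
      rw [e2]
      calc _ ≤ 2 * (2 * ((r * d + 1) * (r * (K₀ + D) + 1))) := by gcongr
        _ = _ := by ring
  rw [hVGN, image_union]
  refine (card_union_le _ _).trans ((add_le_add h1 h2).trans ?_)
  have e1 : r * K₀ + r * r * D ≤ (K₀ + D) * (r + 1) ^ 2 := by
    have : r * K₀ ≤ (r + 1) ^ 2 * K₀ := Nat.mul_le_mul_right _ (by nlinarith)
    have : r * r * D ≤ (r + 1) ^ 2 * D := Nat.mul_le_mul_right _ (by nlinarith)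
    linarith
  have e2 : (r * d + 1) * (r * (K₀ + D) + 1) ≤ ((r + 1) * (d + 1)) * ((r + 1) * (K₀ + D + 1)) :=
    Nat.mul_le_mul (by nlinarith) (by nlinarith)
  nlinarith

/-- The vertical decomposition of the plane by families of stacks of graphs. -/
noncomputable def cellDecomposition (A : ∀ γ, CurveStack (Z γ)) (X : ι → ι → Finset ℝ)
    {Γ : Finset ι} {K₀ D d : ℕ}
    (hK : ∀ γ ∈ Γ, (A γ).exceptional.card ≤ K₀) (hd : ∀ γ ∈ Γ, ∀ x, (A γ).height x ≤ d)
    (hD : ∀ α ∈ Γ, ∀ β ∈ Γ, α ≠ β → (X α β).card ≤ D)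
    (hX : ∀ α ∈ Γ, ∀ β ∈ Γ, α ≠ β → ∀ z, z ∈ Z α → z ∈ Z β → z.1 ∈ X α β)
    {V : Finset (ℝ × ℝ)} (hV : ∀ p ∈ V, ∀ q ∈ V, p.1 = q.1 → p = q)
    (hG : ∀ p ∈ V, ∀ α ∈ Γ, ∀ β ∈ Γ, α ≠ β → p.1 ∈ X α β → p ∈ Z α ∧ p ∈ Z β) :
    CellDecomposition V Γ Z (K₀ + D + 4 * (d + 1) * (K₀ + D + 1)) where
  cell S p := V.filter (SameCell A X S p)
  subset S p := filter_subset _ _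
  mem_self S p hp := mem_filter.2 ⟨hp, Or.inl rfl⟩
  eq_of_mem S p _ q hq := by
    have hpq := (mem_filter.1 hq).2
    exact filter_congr fun r _ => ⟨hpq.trans, hpq.symm.trans⟩
  card_le S hS := by
    convert card_image_sameCell_le (fun γ hγ => hK γ (hS hγ)) (fun γ hγ => hd γ (hS hγ))
      (fun α hα β hβ => hD α (hS hα) β (hS hβ)) (fun α hα β hβ => hX α (hS hα) β (hS hβ)) hV
      (f := fun p => V.filter (SameCell A X S p))
      fun p _ q _ hpq => filter_congr fun r _ => ⟨hpq.symm.trans, hpq.trans⟩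
  exists_defining S hS p hp := by
    obtain ⟨D, hD, h⟩ := exists_defining_sameCell (A := A) (X := X) (S := S) (p := p)
      (fun α hα β hβ => hX α (hS hα) β (hS hβ)) (fun α hα β hβ => hG p hp α (hS hα) β (hS hβ))
    exact ⟨D, hD, fun γ hγ hγD => filter_congr fun q _ => h γ hγ hγD q⟩
  mem_curve S _ γ hγ p _ q hq hpγ := (mem_filter.1 hq).2.mem_curve hγ hpγ

end CurveStack

end PlanarCells

section RootContinuity

open Filter Topology

/-- The elements of a finite set of reals in increasing order, extended by zero. -/
noncomputable def Finset.nthSorted (R : Finset ℝ) (j : ℕ) : ℝ :=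
  if h : j < R.card then R.orderEmbOfFin rfl ⟨j, h⟩ else 0

lemma Finset.nthSorted_of_strictMono {R : Finset ℝ} {n : ℕ} {r : Fin n → ℝ} (hr : StrictMono r)
    (hR : ∀ y, y ∈ R ↔ ∃ i, r i = y) :
    R.card = n ∧ ∀ i : Fin n, R.nthSorted i = r i := by
  have hc : R.card = n := by
    have : R = Finset.univ.map ⟨r, hr.injective⟩ := by
      ext y
      simp [hR]
    rw [this, Finset.card_map, Finset.card_fin]
  subst hc
  refine ⟨rfl, fun i => ?_⟩
  rw [Finset.orderEmbOfFin_unique rfl (fun i => (hR _).2 ⟨i, rfl⟩) hr]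
  simp [Finset.nthSorted]

lemma Finset.mem_iff_nthSorted {R : Finset ℝ} {y : ℝ} :
    y ∈ R ↔ ∃ j < R.card, R.nthSorted j = y := by
  constructor
  · intro hy
    rw [← Finset.mem_coe, ← Finset.range_orderEmbOfFin R rfl] at hy
    obtain ⟨i, rfl⟩ := hy
    exact ⟨i, i.2, by simp [Finset.nthSorted]⟩
  · rintro ⟨j, hj, rfl⟩
    rw [Finset.nthSorted, dif_pos hj]
    exact Finset.orderEmbOfFin_mem _ _ _

lemma Finset.nthSorted_lt {R : Finset ℝ} {i j : ℕ} (hij : i < j) (hj : j < R.card) :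
    R.nthSorted i < R.nthSorted j := by
  rw [Finset.nthSorted, dif_pos (hij.trans hj), Finset.nthSorted, dif_pos hj]
  exact (R.orderEmbOfFin rfl).strictMono hij

/-- A simple root depends on the parameter as a single nearby root. -/
lemma eventually_existsUnique_root {F F' : ℝ → ℝ → ℝ} (hF : Continuous fun z : ℝ × ℝ => F z.1 z.2)
    (hF' : Continuous fun z : ℝ × ℝ => F' z.1 z.2)
    (hd : ∀ x y, HasDerivAt (F x) (F' x y) y) {x₀ y₀ : ℝ} (h₀ : F x₀ y₀ = 0)
    (h₀' : F' x₀ y₀ ≠ 0) {ε : ℝ} (hε : 0 < ε) :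
    ∃ δ, 0 < δ ∧ δ ≤ ε ∧ ∀ᶠ x in 𝓝 x₀, ∃ r, |r - y₀| < δ ∧ F x r = 0 ∧
      ∀ y, |y - y₀| < δ → F x y = 0 → y = r := by
  set σ := F' x₀ y₀ with hσ
  have hpos : ∀ᶠ z : ℝ × ℝ in 𝓝 (x₀, y₀), 0 < σ * F' z.1 z.2 := by
    have hc : Continuous fun z : ℝ × ℝ => σ * F' z.1 z.2 := by fun_prop
    refine hc.continuousAt.eventually (lt_mem_nhds ?_)
    exact mul_self_pos.2 h₀'
  rw [nhds_prod_eq, eventually_prod_iff] at hpos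
  obtain ⟨px, hpx, py, hpy, hp⟩ := hpos
  obtain ⟨η, hη, hball⟩ := Metric.eventually_nhds_iff.1 hpy
  set δ := min ε (η / 2) with hδ
  have hδ0 : 0 < δ := lt_min hε (by positivity)
  have hδη : δ < η := (min_le_right _ _).trans_lt (by linarith)
  have hpyI : ∀ y ∈ Set.Icc (y₀ - δ) (y₀ + δ), py y := by
    intro y hy
    refine hball ?_
    rw [Real.dist_eq, abs_lt]
    constructor <;> linarith [hy.1, hy.2]
  have hcx : ∀ x, Continuous (F x) := fun x => hF.comp (by fun_prop : Continuous fun y => (x, y))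
  have hmono : ∀ x, px x → StrictMonoOn (fun y => σ * F x y) (Set.Icc (y₀ - δ) (y₀ + δ)) := by
    intro x hx
    refine strictMonoOn_of_deriv_pos (convex_Icc _ _) ?_ fun y hy => ?_
    · exact ((hcx x).const_smul σ).continuousOn
    · rw [((hd x y).const_mul σ).deriv]
      exact hp hx (hpyI y (interior_subset hy))
  have hx₀ : px x₀ := hpx.self_of_nhds
  have hlo : σ * F x₀ (y₀ - δ) < 0 := by
    have := hmono x₀ hx₀ (a := y₀ - δ) (b := y₀) ⟨le_rfl, by linarith⟩
      ⟨by linarith, by linarith⟩ (by linarith)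
    simpa [h₀] using this
  have hhi : 0 < σ * F x₀ (y₀ + δ) := by
    have := hmono x₀ hx₀ (a := y₀) (b := y₀ + δ) ⟨by linarith, by linarith⟩
      ⟨by linarith, le_rfl⟩ (by linarith)
    simpa [h₀] using this
  have hcy : ∀ y, Continuous fun x => σ * F x y := fun y =>
    continuous_const.mul (hF.comp (by fun_prop : Continuous fun x => (x, y)))
  refine ⟨δ, hδ0, min_le_left _ _, ?_⟩
  filter_upwards [hpx, (hcy (y₀ - δ)).continuousAt.eventually (gt_mem_nhds hlo),
    (hcy (y₀ + δ)).continuousAt.eventually (lt_mem_nhds hhi)] with x hx hxlo hxhi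
  obtain ⟨r, hr, hr0⟩ := intermediate_value_Ioo (by linarith : y₀ - δ ≤ y₀ + δ)
    ((hcx x).const_smul σ).continuousOn ⟨hxlo, hxhi⟩
  have hr0' : σ * F x r = 0 := hr0
  refine ⟨r, abs_lt.2 ⟨by linarith [hr.1], by linarith [hr.2]⟩,
    (mul_eq_zero.1 hr0').resolve_left h₀', fun y hy hy0 => ?_⟩
  rw [abs_lt] at hy
  refine (hmono x hx).injOn ⟨by linarith, by linarith⟩ ⟨hr.1.le, hr.2.le⟩ ?_
  simp only [hy0, hr0', mul_zero]

/-- Real roots of a function depending on a parameter vary continuously as long as they are simple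
and bounded. -/
lemma eventually_nthSorted_near {F F' : ℝ → ℝ → ℝ} (hF : Continuous fun z : ℝ × ℝ => F z.1 z.2)
    (hF' : Continuous fun z : ℝ × ℝ => F' z.1 z.2)
    (hd : ∀ x y, HasDerivAt (F x) (F' x y) y) {R : ℝ → Finset ℝ} {x₀ : ℝ}
    (hR : ∀ᶠ x in 𝓝 x₀, ∀ y, y ∈ R x ↔ F x y = 0)
    (hs : ∀ y, F x₀ y = 0 → F' x₀ y ≠ 0) {B : ℝ}
    (hB : ∀ᶠ x in 𝓝 x₀, ∀ y, F x y = 0 → |y| ≤ B) {ε : ℝ} (hε : 0 < ε) :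
    ∀ᶠ x in 𝓝 x₀, (R x).card = (R x₀).card ∧
      ∀ j < (R x₀).card, |(R x).nthSorted j - (R x₀).nthSorted j| < ε := by
  have hR₀ := hR.self_of_nhds
  set n := (R x₀).card with hn
  set y₀ : Fin n → ℝ := fun i => (R x₀).nthSorted i with hy₀
  have hmono : StrictMono y₀ := fun i j hij => Finset.nthSorted_lt hij j.2
  have hroot : ∀ y, F x₀ y = 0 ↔ ∃ i, y₀ i = y := by
    intro y
    rw [← hR₀, Finset.mem_iff_nthSorted]
    exact ⟨fun ⟨j, hj, h⟩ => ⟨⟨j, hj⟩, h⟩, fun ⟨i, h⟩ => ⟨i, i.2, h⟩⟩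
  obtain ⟨η, hη, hsep⟩ : ∃ η > 0, ∀ i j, i < j → y₀ i + η < y₀ j - η := by
    have : ∀ᶠ η : ℝ in 𝓝[>] 0, ∀ i j, i < j → y₀ i + η < y₀ j - η := by
      rw [eventually_all]
      intro i
      rw [eventually_all]
      intro j
      by_cases hij : i < j
      · have h0 : y₀ i + 0 < y₀ j - 0 := by simpa using hmono hij
        have hc : ContinuousAt (fun η : ℝ => y₀ j - η - (y₀ i + η)) 0 := by fun_prop
        filter_upwards [nhdsWithin_le_nhds (hc.eventually (lt_mem_nhds (sub_pos.2 h0)))]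
          with η h _
        linarith
      · exact Eventually.of_forall fun η h => absurd h hij
    obtain ⟨η, h1, h2⟩ := (this.and self_mem_nhdsWithin).exists
    exact ⟨η, h2, h1⟩
  have hε' : 0 < min ε η := lt_min hε hη
  choose δ hδ0 hδε hδ using fun i => eventually_existsUnique_root hF hF' hd
    ((hroot (y₀ i)).2 ⟨i, rfl⟩) (hs _ ((hroot (y₀ i)).2 ⟨i, rfl⟩)) hε'
  have hout : ∀ᶠ x in 𝓝 x₀, ∀ y ∈ Set.Icc (-B) B ∩ {y | ∀ i, δ i ≤ |y - y₀ i|},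
      F x y ≠ 0 := by
    have hcomp : IsCompact (Set.Icc (-B) B ∩ {y | ∀ i, δ i ≤ |y - y₀ i|}) := by
      refine isCompact_Icc.inter_right ?_
      rw [Set.ofPred_forall]
      exact isClosed_iInter fun i => isClosed_le continuous_const (by fun_prop)
    refine hcomp.eventually_forall_of_forall_eventually fun y hy => ?_
    refine hF.continuousAt.eventually_ne (y := (0 : ℝ)) (x := (x₀, y)) fun h => ?_
    obtain ⟨i, hi⟩ := (hroot y).1 h
    have := hy.2 i
    rw [← hi, sub_self, abs_zero] at this
    exact absurd (hδ0 i) this.not_gt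
  filter_upwards [hR, hB, hout, eventually_all.2 hδ] with x hxR hxB hxo hxr
  choose r hr hr0 hru using hxr
  have hrη : ∀ i, |r i - y₀ i| < min ε η := fun i => (hr i).trans_le (hδε i)
  have hrmono : StrictMono r := by
    intro i j hij
    have h1 := abs_lt.1 ((hrη i).trans_le (min_le_right _ _))
    have h2 := abs_lt.1 ((hrη j).trans_le (min_le_right _ _))
    linarith [hsep i j hij]
  obtain ⟨h1, h2⟩ := Finset.nthSorted_of_strictMono (R := R x) hrmono fun y => by
    rw [hxR]
    constructor
    · intro hy
      by_contra! hne
      refine hxo y ⟨abs_le.1 (hxB y hy), fun i => ?_⟩ hy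
      by_contra! hlt
      exact hne i (hru i y hlt hy).symm
    · rintro ⟨i, rfl⟩
      exact hr0 i
  refine ⟨h1, fun j hj => ?_⟩
  rw [h2 ⟨j, hj⟩]
  exact (hrη ⟨j, hj⟩).trans_le (min_le_left _ _)

/-- Near a parameter where the leading coefficient does not vanish, roots are bounded. -/
lemma eventually_root_bounded {n : ℕ} {c : ℕ → ℝ → ℝ} (hc : ∀ i, Continuous (c i)) {x₀ : ℝ}
    (h₀ : c n x₀ ≠ 0) :
    ∃ B : ℝ, ∀ᶠ x in 𝓝 x₀, ∀ y, ∑ i ∈ Finset.range (n + 1), c i x * y ^ i = 0 → |y| ≤ B := by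
  set G : ℝ × ℝ → ℝ := fun z => ∑ i ∈ Finset.range (n + 1), c i z.1 * z.2 ^ (n - i) with hG
  have hGc : Continuous G := by
    refine continuous_finsetSum _ fun i _ => ?_
    exact ((hc i).comp continuous_fst).mul (continuous_snd.pow _)
  have hG0 : G (x₀, 0) ≠ 0 := by
    have : G (x₀, 0) = c n x₀ := by
      simp only [hG]
      rw [Finset.sum_eq_single n]
      · simp
      · intro i hi hne
        have : n - i ≠ 0 := by
          have := Finset.mem_range.1 hi
          omega
        simp [this]
      · simp
    rwa [this]
  have hne := hGc.continuousAt.eventually_ne hG0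
  rw [nhds_prod_eq, eventually_prod_iff] at hne
  obtain ⟨px, hpx, py, hpy, hp⟩ := hne
  obtain ⟨η, hη, hball⟩ := Metric.eventually_nhds_iff.1 hpy
  refine ⟨1 / η, hpx.mono fun x hx y hy => ?_⟩
  by_contra! hlt
  have hy0 : y ≠ 0 := by
    rintro rfl
    rw [abs_zero] at hlt
    exact absurd hlt (by positivity : (0 : ℝ) ≤ 1 / η).not_gt
  refine hp hx (hball (y := y⁻¹) ?_) ?_
  · rw [Real.dist_eq, sub_zero, abs_inv]
    rw [one_div] at hlt
    exact inv_lt_of_inv_lt₀ hη hlt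
  · have : G (x, y⁻¹) = (y ^ n)⁻¹ * ∑ i ∈ Finset.range (n + 1), c i x * y ^ i := by
      simp only [hG]
      rw [Finset.mul_sum]
      refine Finset.sum_congr rfl fun i hi => ?_
      have hi' : i ≤ n := Nat.lt_succ_iff.1 (Finset.mem_range.1 hi)
      rw [inv_pow, ← Nat.sub_add_cancel hi', pow_add, Nat.add_sub_cancel]
      field_simp
    rw [this, hy, mul_zero]

end RootContinuity

section BivariatePolynomial

open Polynomial

lemma Polynomial.squarefree_map_fractionRing {R K : Type*} [CommRing R] [IsDomain R]
    [UniqueFactorizationMonoid R] [Field K] [Algebra R K] [IsFractionRing R K] {H : R[X]}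
    (hH : Squarefree H) : Squarefree (H.map (algebraMap R K)) := by
  classical
  have : NormalizedGCDMonoid R := Nonempty.some inferInstance
  intro q hq
  have hH0 : H.map (algebraMap R K) ≠ 0 :=
    (Polynomial.map_ne_zero_iff (IsFractionRing.injective R K)).2 hH.ne_zero
  have hq0 : q ≠ 0 := by
    rintro rfl
    exact hH0 (by simpa using hq)
  set N := IsLocalization.integerNormalization (nonZeroDivisors R) q with hN
  obtain ⟨b, hb, hbN⟩ := IsLocalization.integerNormalization_spec (nonZeroDivisors R) q
  rw [← hN] at hbN
  have hb0 : algebraMap R K b ≠ 0 := by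
    rw [Ne, IsFractionRing.to_map_eq_zero_iff]
    exact nonZeroDivisors.ne_zero hb
  have hdvd : N.primPart.map (algebraMap R K) ∣ q := by
    have h1 : N.primPart.map (algebraMap R K) ∣ C (algebraMap R K b) * q := by
      rw [← smul_eq_C_mul, algebraMap_smul, ← hbN]
      exact Polynomial.map_dvd _ N.primPart_dvd
    exact ((isUnit_C.2 hb0.isUnit).dvd_mul_left).1 h1
  have hp : (N.primPart * N.primPart).IsPrimitive :=
    N.isPrimitive_primPart.mul N.isPrimitive_primPart
  have h2 : N.primPart * N.primPart ∣ H := by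
    refine hp.dvd_of_fraction_map_dvd_fraction_map (K := K) ?_
    rw [Polynomial.map_mul]
    exact (mul_dvd_mul hdvd hdvd).trans hq
  exact Polynomial.isUnit_or_eq_zero_of_isUnit_integerNormalization_primPart hq0 (hH _ h2)

lemma UniqueFactorizationMonoid.exists_squarefree_dvd_dvd_pow {M : Type*} [CommMonoidWithZero M]
    [UniqueFactorizationMonoid M] [Nontrivial M] {a : M} (ha : a ≠ 0) :
    ∃ b, Squarefree b ∧ b ∣ a ∧ ∃ n, a ∣ b ^ n := by
  classical
  let : StrongNormalizationMonoid M := UniqueFactorizationMonoid.strongNormalizationMonoid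
  exact ⟨radical a, squarefree_radical, radical_dvd_self, exists_dvd_radical_self_pow ha⟩

lemma Polynomial.resultant_derivative_ne_zero {H : ℝ[X][X]} (hH : Squarefree H) :
    resultant H (derivative H) ≠ 0 := by
  have h1 : Squarefree (H.map (algebraMap ℝ[X] (FractionRing ℝ[X]))) :=
    squarefree_map_fractionRing hH
  have : CharZero (FractionRing ℝ[X]) :=
    charZero_of_injective_algebraMap (IsFractionRing.injective ℝ[X] (FractionRing ℝ[X]))
  rw [← PerfectField.separable_iff_squarefree] at h1
  have h2 := resultant_ne_zero _ _ h1
  have hinj := IsFractionRing.injective ℝ[X] (FractionRing ℝ[X])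
  rw [derivative_map, natDegree_map_eq_of_injective hinj, natDegree_map_eq_of_injective hinj,
    resultant_map_map] at h2
  exact fun h => h2 (by rw [h, map_zero])

lemma Polynomial.natDegree_resultant_le {f g : ℝ[X][X]} {m n e : ℕ}
    (hf : ∀ i, (f.coeff i).natDegree ≤ e) (hg : ∀ i, (g.coeff i).natDegree ≤ e) :
    (resultant f g m n).natDegree ≤ (m + n) * e := by
  rw [resultant, Matrix.det_apply]
  refine natDegree_sum_le_of_forall_le _ _ fun σ _ => ?_
  refine (natDegree_smul_le _ _).trans ((natDegree_prod_le _ _).trans ?_)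
  refine (Finset.sum_le_card_nsmul _ _ e fun i _ => ?_).trans (by simp)
  simp only [sylvester, Matrix.of_apply]
  induction i using Fin.addCases with
  | left i => simp only [Fin.addCases_left]; split_ifs <;> simp [hg]
  | right i => simp only [Fin.addCases_right]; split_ifs <;> simp [hf]

lemma Polynomial.Bivariate.coeff_coeff_swap (p : ℝ[X][X]) (i j : ℕ) :
    ((Bivariate.swap p).coeff i).coeff j = (p.coeff j).coeff i := by
  induction p using Polynomial.induction_on' with
  | add p q hp hq => simp [hp, hq]
  | monomial n a =>
    induction a using Polynomial.induction_on' with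
    | add p q hp hq => simp only [map_add, coeff_add, hp, hq]
    | monomial m r =>
      rw [← C_mul_X_pow_eq_monomial, ← C_mul_X_pow_eq_monomial]
      simp only [map_mul, map_pow, Bivariate.swap_X, Bivariate.swap_Y, Bivariate.swap_C_C]
      rw [← C_pow, mul_right_comm, ← C_pow, ← C_mul, ← C_mul, coeff_C_mul_X_pow,
        coeff_C_mul_X_pow]
      split_ifs <;> simp [coeff_X_pow, *]

lemma Polynomial.Bivariate.natDegree_swap_le_iff {p : ℝ[X][X]} {e : ℕ} :
    (Bivariate.swap p).natDegree ≤ e ↔ ∀ i, (p.coeff i).natDegree ≤ e := by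
  simp only [natDegree_le_iff_coeff_eq_zero]
  constructor
  · intro h i j hj
    rw [← coeff_coeff_swap, h j hj, coeff_zero]
  · intro h j hj
    ext i
    rw [coeff_coeff_swap, h i j hj, coeff_zero]

/-- A bivariate polynomial vanishes on the same set as a squarefree one of no larger degrees. -/
lemma Polynomial.Bivariate.exists_squarefree {G : ℝ[X][X]} (hG : G ≠ 0) :
    ∃ H : ℝ[X][X], Squarefree H ∧ H.natDegree ≤ G.natDegree ∧
      (Bivariate.swap H).natDegree ≤ (Bivariate.swap G).natDegree ∧
      ∀ x y, H.evalEval x y = 0 ↔ G.evalEval x y = 0 := by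
  obtain ⟨H, hs, hHG, n, hn⟩ := UniqueFactorizationMonoid.exists_squarefree_dvd_dvd_pow hG
  have hsw : Bivariate.swap G ≠ 0 := fun h => hG ((map_eq_zero_iff _ (AlgEquiv.injective _)).1 h)
  have hdvd : Bivariate.swap H ∣ Bivariate.swap G := by
    obtain ⟨L, rfl⟩ := hHG
    exact ⟨Bivariate.swap L, map_mul _ _ _⟩
  refine ⟨H, hs, natDegree_le_of_dvd hHG hG, natDegree_le_of_dvd hdvd hsw,
    fun x y => ⟨fun h => ?_, fun h => ?_⟩⟩
  · exact zero_dvd_iff.1 (h ▸ evalEval_dvd x y hHG)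
  · have h1 := evalEval_dvd x y hn
    rw [h, zero_dvd_iff, evalEval_pow] at h1
    exact eq_zero_of_pow_eq_zero h1

lemma Polynomial.Bivariate.continuous_eval_map (H : ℝ[X][X]) :
    Continuous fun z : ℝ × ℝ => (H.map (evalRingHom z.1)).eval z.2 := by
  simp only [eval_map, eval₂_eq_sum_range, coe_evalRingHom]
  fun_prop

lemma Polynomial.Bivariate.eval_map_evalRingHom (H : ℝ[X][X]) (x y : ℝ) :
    (H.map (evalRingHom x)).eval y = H.evalEval x y := by
  rw [eval_map, eval₂_evalRingHom]

end BivariatePolynomial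

section BivariateStack

open Polynomial Filter Topology

/-- Away from finitely many vertical lines, the real roots of a bivariate polynomial form a stack
as soon as they vary continuously. -/
noncomputable def CurveStack.ofRoots {Z : Set (ℝ × ℝ)} (E : Finset ℝ) (R : ℝ → Finset ℝ)
    (hR : ∀ x ∉ E, ∀ y, (x, y) ∈ Z ↔ y ∈ R x)
    (h : ∀ x₀ ∉ E, ∀ ε > 0, ∀ᶠ x in 𝓝 x₀, (R x).card = (R x₀).card ∧
      ∀ j < (R x₀).card, |(R x).nthSorted j - (R x₀).nthSorted j| < ε) :
    CurveStack Z :=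
  have height_eq : ∀ x x', (∀ z ∈ Set.uIcc x x', z ∉ E) → (R x).card = (R x').card := by
    intro x x' hx
    refine isPreconnected_uIcc.constant (f := fun x => (R x).card) (fun z hz => ?_) Set.left_mem_uIcc Set.right_mem_uIcc
    have h1 := h z (hx z hz) 1 one_pos
    exact (tendsto_const_nhds.congr' (h1.mono fun w hw => hw.1.symm)).mono_left
      nhdsWithin_le_nhds
  { exceptional := E
    height := fun x => (R x).card
    branch := fun j x => (R x).nthSorted j
    mem_iff := fun x hx y => (hR x hx y).trans Finset.mem_iff_nthSorted
    branch_inj := by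
      intro x _ i hi j hj hij
      rcases lt_trichotomy i j with h | h | h
      · exact absurd hij (Finset.nthSorted_lt h hj).ne
      · exact h
      · exact absurd hij (Finset.nthSorted_lt h hi).ne'
    height_eq := height_eq
    continuousOn := by
      intro x x' hx j hj z hz
      refine ContinuousAt.continuousWithinAt (Metric.tendsto_nhds.2 fun ε hε => ?_)
      have hc : (R x).card = (R z).card :=
        height_eq x z fun w hw => hx w (Set.uIcc_subset_uIcc_left hz hw)
      exact (h z (hx z hz) ε hε).mono fun w hw => hw.2 j (hc ▸ hj) }

lemma exists_curveStack_of_squarefree {H : ℝ[X][X]} (hH : Squarefree H) {d e : ℕ}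
    (hd : H.natDegree ≤ d) (he : ∀ i, (H.coeff i).natDegree ≤ e) :
    ∃ A : CurveStack {z : ℝ × ℝ | H.evalEval z.1 z.2 = 0},
      A.exceptional.card ≤ 2 * d * e + e ∧ ∀ x, A.height x ≤ d := by
  classical
  set Δ := resultant H (derivative H) with hΔ
  have hΔ0 : Δ ≠ 0 := resultant_derivative_ne_zero hH
  have hl0 : H.leadingCoeff ≠ 0 := leadingCoeff_ne_zero.2 hH.ne_zero
  set E : Finset ℝ := Δ.roots.toFinset ∪ H.leadingCoeff.roots.toFinset with hE
  set h : ℝ → ℝ[X] := fun x => H.map (evalRingHom x) with hh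
  have hEΔ : ∀ x ∉ E, Δ.eval x ≠ 0 ∧ H.leadingCoeff.eval x ≠ 0 := by
    intro x hx
    simpa [hE, hΔ0, hl0] using hx
  have h0 : ∀ x ∉ E, h x ≠ 0 := by
    intro x hx h0
    have h1 : (h x).coeff H.natDegree = 0 := by rw [h0, coeff_zero]
    rw [hh] at h1
    simp only [coeff_map, coe_evalRingHom] at h1
    exact (hEΔ x hx).2 h1
  have hR : ∀ x ∉ E, ∀ y, y ∈ (h x).roots.toFinset ↔ (h x).eval y = 0 := by
    intro x hx y
    rw [Multiset.mem_toFinset, mem_roots (h0 x hx), IsRoot]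
  have hsimple : ∀ x ∉ E, ∀ y, (h x).eval y = 0 → (derivative (h x)).eval y ≠ 0 := by
    intro x hx y h1 h2
    rcases Nat.eq_zero_or_pos H.natDegree with hn | hn
    · rw [hh] at h1
      simp only at h1
      rw [eq_C_of_natDegree_eq_zero hn] at h1
      refine (hEΔ x hx).2 ?_
      rw [leadingCoeff, hn]
      simpa using h1
    · obtain ⟨p, q, -, -, hpq⟩ := exists_mul_add_mul_eq_C_resultant H (derivative H) le_rfl le_rfl
        (Or.inl hn.ne')
      have h3 := congrArg (fun P : ℝ[X][X] => (P.map (evalRingHom x)).eval y) hpq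
      simp only [Polynomial.map_add, Polynomial.map_mul, eval_add, eval_mul, map_C, eval_C,
        coe_evalRingHom, ← derivative_map] at h3
      change (h x).eval y * _ + (derivative (h x)).eval y * _ = _ at h3
      rw [h1, h2, zero_mul, zero_mul, add_zero] at h3
      exact (hEΔ x hx).1 h3.symm
  have hev : ∀ x₀ ∉ E, ∀ᶠ x in 𝓝 x₀, x ∉ E := fun x₀ hx₀ =>
    E.finite_toSet.isClosed.isOpen_compl.mem_nhds hx₀
  refine ⟨CurveStack.ofRoots E (fun x => (h x).roots.toFinset) (fun x hx y => ?_) ?_, ?_, ?_⟩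
  · rw [hR x hx, Set.mem_ofPred_eq, ← Bivariate.eval_map_evalRingHom]
  · intro x₀ hx₀ ε hε
    obtain ⟨B, hB⟩ := eventually_root_bounded (n := H.natDegree)
      (c := fun i x => (H.coeff i).eval x) (fun i => (H.coeff i).continuous) (hEΔ x₀ hx₀).2
    refine eventually_nthSorted_near (F := fun x y => (h x).eval y)
      (F' := fun x y => ((derivative H).map (evalRingHom x)).eval y)
      (Bivariate.continuous_eval_map H) (Bivariate.continuous_eval_map _)
      (fun x y => ?_) ((hev x₀ hx₀).mono hR) (fun y hy => ?_) (B := B) ?_ hε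
    · rw [← derivative_map]
      exact (h x).hasDerivAt y
    · rw [← derivative_map]
      exact hsimple x₀ hx₀ y hy
    · refine hB.mono fun x hx y hy => hx y ?_
      rw [← hy, hh]
      simp only [eval_map, eval₂_eq_sum_range, coe_evalRingHom]
  · change E.card ≤ _
    refine (Finset.card_union_le _ _).trans (add_le_add ?_ ?_)
    · refine (Multiset.toFinset_card_le _).trans ((card_roots' _).trans
        ((natDegree_resultant_le he fun i => ?_).trans ?_))
      · rw [coeff_derivative]
        have : ((i : ℝ[X]) + 1) = C ((i : ℝ) + 1) := by simp
        rw [this]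
        exact (natDegree_mul_C_le _ _).trans (he _)
      · have := natDegree_derivative_le H
        gcongr
        omega
    · exact (Multiset.toFinset_card_le _).trans ((card_roots' _).trans (he _))
  · intro x
    change (h x).roots.toFinset.card ≤ d
    exact (Multiset.toFinset_card_le _).trans ((card_roots' _).trans (natDegree_map_le.trans hd))

/-- The zero set of a nonzero bivariate polynomial of bounded degrees is a stack, up to a bounded
number of vertical lines. -/
lemma exists_curveStack {G : ℝ[X][X]} (hG : G ≠ 0) {d : ℕ} (hd : G.natDegree ≤ d)
    (hd' : (Bivariate.swap G).natDegree ≤ d) :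
    ∃ A : CurveStack {z : ℝ × ℝ | G.evalEval z.1 z.2 = 0},
      A.exceptional.card ≤ 2 * d * d + d ∧ ∀ x, A.height x ≤ d := by
  obtain ⟨H, hs, h1, h2, h3⟩ := Bivariate.exists_squarefree hG
  have : {z : ℝ × ℝ | G.evalEval z.1 z.2 = 0} = {z | H.evalEval z.1 z.2 = 0} := by
    ext z
    exact (h3 _ _).symm
  rw [this]
  exact exists_curveStack_of_squarefree hs (h1.trans hd)
    (Bivariate.natDegree_swap_le_iff.1 (h2.trans hd'))

/-- A finite zero set of a bivariate polynomial has cardinality bounded in terms of the degrees. -/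
lemma Polynomial.Bivariate.ncard_zeros_le {G : ℝ[X][X]} {d : ℕ} (hd : G.natDegree ≤ d)
    (hd' : (Bivariate.swap G).natDegree ≤ d)
    (hfin : {z : ℝ × ℝ | G.evalEval z.1 z.2 = 0}.Finite) :
    {z : ℝ × ℝ | G.evalEval z.1 z.2 = 0}.ncard ≤ (2 * d * d + d) * d := by
  classical
  have hG : G ≠ 0 := by
    rintro rfl
    refine (Set.infinite_univ (α := ℝ × ℝ)) ?_
    convert hfin
    simp
  obtain ⟨A, hA, -⟩ := exists_curveStack hG hd hd'
  generalize hZ : {z : ℝ × ℝ | G.evalEval z.1 z.2 = 0} = Z at *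
  have hmem : ∀ z ∈ Z, z.1 ∈ A.exceptional := by
    rintro ⟨x, y⟩ hz
    by_contra hx
    obtain ⟨j, hj, -⟩ := (A.mem_iff x hx y).1 hz
    obtain ⟨δ, hδ, hball⟩ := Metric.mem_nhds_iff.1
      (A.exceptional.finite_toSet.isClosed.isOpen_compl.mem_nhds hx)
    refine (Set.Ico_infinite (show x < x + δ by linarith)) ((hfin.image Prod.fst).subset ?_)
    intro w hw
    have hsub : ∀ z ∈ Set.uIcc x w, z ∉ A.exceptional := by
      intro z hz
      rw [Set.uIcc_of_le hw.1] at hz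
      refine hball ?_
      rw [Metric.mem_ball, Real.dist_eq, abs_of_nonneg (by linarith [hz.1])]
      linarith [hz.2, hw.2]
    have hw' : w ∉ A.exceptional := hsub w Set.right_mem_uIcc
    exact ⟨(w, A.branch j w), (A.mem_iff w hw' _).2 ⟨j, A.height_eq x w hsub ▸ hj, rfl⟩, rfl⟩
  have hfib : ∀ x, (G.map (evalRingHom x)) ≠ 0 := by
    intro x hx
    refine (Set.infinite_univ (α := ℝ)) ((hfin.image Prod.snd).subset fun y _ => ?_)
    refine ⟨(x, y), ?_, rfl⟩
    rw [← hZ]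
    change G.evalEval x y = 0
    rw [← eval_map_evalRingHom, hx, eval_zero]
  have hsub : Z ⊆ (A.exceptional.biUnion fun x =>
      ((G.map (evalRingHom x)).roots.toFinset.image fun y => (x, y)) : Finset (ℝ × ℝ)) := by
    rintro ⟨x, y⟩ hz
    simp only [Finset.coe_biUnion, Set.mem_iUnion, Finset.coe_image]
    refine ⟨x, hmem _ hz, y, ?_, rfl⟩
    rw [Finset.mem_coe, Multiset.mem_toFinset, mem_roots (hfib x), IsRoot, eval_map_evalRingHom]
    rw [← hZ] at hz
    exact hz
  refine (Set.ncard_le_ncard hsub (Finset.finite_toSet _)).trans ?_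
  rw [Set.ncard_coe_finset]
  refine (Finset.card_biUnion_le_card_mul _ _ d fun x _ => ?_).trans (Nat.mul_le_mul_right _ hA)
  exact Finset.card_image_le.trans ((Multiset.toFinset_card_le _).trans
    ((card_roots' _).trans (natDegree_map_le.trans hd)))

end BivariateStack

section Shear

open Polynomial

/-- The plane polynomial `f` in the coordinates of the shear `(x, y) ↦ (x - l * y, y)`. -/
noncomputable def shearPolynomial (l : ℝ) (f : MvPolynomial (Fin 2) ℝ) : ℝ[X][X] :=
  MvPolynomial.aeval ![C X + C (C l) * X, X] f

/-- The shear `(x, y) ↦ (x - l * y, y)` of the plane. -/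
noncomputable def shearEquiv (l : ℝ) : EuclideanSpace ℝ (Fin 2) ≃ ℝ × ℝ where
  toFun p := (p 0 - l * p 1, p 1)
  invFun z := !₂[z.1 + l * z.2, z.2]
  left_inv p := by
    ext i
    fin_cases i <;> simp
  right_inv z := by simp

lemma evalEval_shearPolynomial (l : ℝ) (f : MvPolynomial (Fin 2) ℝ) (z : ℝ × ℝ) :
    (shearPolynomial l f).evalEval z.1 z.2 = MvPolynomial.eval (fun i => (shearEquiv l).symm z i) f := by
  rw [shearPolynomial, ← coe_evalEvalRingHom, MvPolynomial.aeval_def, MvPolynomial.hom_eval₂]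
  have h1 : (evalEvalRingHom z.1 z.2).comp (algebraMap ℝ ℝ[X][X]) = RingHom.id ℝ := by
    ext r
    simp
  rw [h1, MvPolynomial.eval₂_id]
  congr 2
  ext i
  fin_cases i
  · simp [shearEquiv]
  · change evalEval z.1 z.2 X = _
    rw [evalEval_X]
    rfl

lemma shearPolynomial_ne_zero (l : ℝ) {f : MvPolynomial (Fin 2) ℝ} (hf : f ≠ 0) :
    shearPolynomial l f ≠ 0 := by
  intro h
  refine hf (MvPolynomial.funext fun w => ?_)
  have h1 := evalEval_shearPolynomial l f (shearEquiv l (WithLp.toLp 2 w))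
  rw [h, evalEval_zero, Equiv.symm_apply_apply] at h1
  rw [map_zero]
  exact h1.symm

lemma natDegree_aeval_bivariate_le {f : MvPolynomial (Fin 2) ℝ} {d : ℕ}
    (hf : f.totalDegree ≤ d) {v : Fin 2 → ℝ[X][X]} (hv : ∀ i, (v i).natDegree ≤ 1) :
    (MvPolynomial.aeval v f).natDegree ≤ d := by
  rw [← MvPolynomial.aeval_map_algebraMap ℝ[X] v f]
  simpa using MvPolynomial.aeval_natDegree_le _
    ((Finset.sup_mono (MvPolynomial.support_map_subset _ _)).trans hf) v hv

lemma natDegree_shearPolynomial_le (l : ℝ) {f : MvPolynomial (Fin 2) ℝ} {d : ℕ}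
    (hf : f.totalDegree ≤ d) :
    (shearPolynomial l f).natDegree ≤ d ∧ (Bivariate.swap (shearPolynomial l f)).natDegree ≤ d := by
  constructor
  · refine natDegree_aeval_bivariate_le hf fun i => ?_
    fin_cases i
    · exact natDegree_add_le_of_degree_le (by simp) (natDegree_C_mul_le _ _ |>.trans (by simp))
    · simp
  · have h1 : Bivariate.swap (shearPolynomial l f) =
        MvPolynomial.aeval (fun i => Bivariate.swap (![C X + C (C l) * X, X] i)) f :=
      (MvPolynomial.comp_aeval_apply _ Bivariate.swap.toAlgHom f)
    rw [h1]
    refine natDegree_aeval_bivariate_le hf fun i => ?_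
    fin_cases i
    · change (Bivariate.swap (C X + C (C l) * X)).natDegree ≤ 1
      rw [map_add, map_mul, Bivariate.swap_X, Bivariate.swap_Y, Bivariate.swap_C_C]
      exact natDegree_add_le_of_degree_le (by simp) (natDegree_C_mul_le _ _ |>.trans (by simp))
    · change (Bivariate.swap X).natDegree ≤ 1
      rw [Bivariate.swap_Y]
      simp

lemma exists_shear_fst_injOn (S : Finset (EuclideanSpace ℝ (Fin 2))) :
    ∃ l : ℝ, ∀ p ∈ S, ∀ q ∈ S, (shearEquiv l p).1 = (shearEquiv l q).1 → p = q := by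
  classical
  obtain ⟨l, hl⟩ := Infinite.exists_notMem_finset
    ((S ×ˢ S).image fun z => (z.1 0 - z.2 0) / (z.1 1 - z.2 1))
  refine ⟨l, fun p hp q hq h => ?_⟩
  have h : p 0 - l * p 1 = q 0 - l * q 1 := h
  by_cases h1 : p 1 = q 1
  · ext i
    fin_cases i
    · rw [h1] at h
      exact sub_left_injective h
    · exact h1
  · refine absurd (Finset.mem_image.2 ⟨(p, q), Finset.mem_product.2 ⟨hp, hq⟩, ?_⟩) hl
    rw [div_eq_iff (sub_ne_zero.2 h1)]
    linarith

end Shear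

section PlaneCurves

open Finset
open scoped Classical

/-- The Pach–Sharir incidence bound for plane algebraic curves of bounded degree. -/
theorem exists_incidence_bound_curves (d k s : ℕ) (hk : 1 ≤ k) :
    ∃ C : ℝ, 0 < C ∧ ∀ (V : Finset (EuclideanSpace ℝ (Fin 2)))
      (Γ : Finset (Set (EuclideanSpace ℝ (Fin 2)))),
      (∀ γ ∈ Γ, ∃ f : MvPolynomial (Fin 2) ℝ, f ≠ 0 ∧ f.totalDegree ≤ d ∧
        γ = {x | MvPolynomial.eval (fun i => x i) f = 0}) →
      (∀ α ∈ Γ, ∀ β ∈ Γ, α ≠ β → (α ∩ β).Finite) →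
      (∀ S : Finset (EuclideanSpace ℝ (Fin 2)), S.card = k →
        (Γ.filter fun γ => (S : Set (EuclideanSpace ℝ (Fin 2))) ⊆ γ).card ≤ s) →
      ∑ γ ∈ Γ, (((V : Set (EuclideanSpace ℝ (Fin 2))) ∩ γ).ncard : ℝ) ≤
        C * ((V.card : ℝ) ^ ((k : ℝ) / (2 * (k : ℝ) - 1)) *
          (Γ.card : ℝ) ^ ((2 * (k : ℝ) - 2) / (2 * (k : ℝ) - 1)) + V.card + Γ.card) := by
  set K₀ := 2 * d * d + d
  set D := (2 * (2 * d) * (2 * d) + 2 * d) * (2 * d)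
  obtain ⟨C, hC, hbound⟩ := exists_incidence_bound (ℝ × ℝ) (Set (EuclideanSpace ℝ (Fin 2))) k s D
    (K₀ + D + 4 * (d + 1) * (K₀ + D + 1)) hk
  refine ⟨C, hC, fun V Γ hΓ hfin hdof => ?_⟩
  have hΓ' : ∀ γ, ∃ f : MvPolynomial (Fin 2) ℝ, f ≠ 0 ∧ f.totalDegree ≤ d ∧
      (γ ∈ Γ → γ = {x | MvPolynomial.eval (fun i => x i) f = 0}) := by
    intro γ
    by_cases hγ : γ ∈ Γ
    · obtain ⟨f, h1, h2, h3⟩ := hΓ γ hγ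
      exact ⟨f, h1, h2, fun _ => h3⟩
    · exact ⟨1, one_ne_zero, by simp, fun h => absurd h hγ⟩
  choose f hf0 hfd hfZ using hΓ'
  have hI : ∀ α β, ∃ I : Finset (EuclideanSpace ℝ (Fin 2)),
      α ∈ Γ → β ∈ Γ → α ≠ β → ∀ p, p ∈ I ↔ p ∈ α ∧ p ∈ β := by
    intro α β
    by_cases h : α ∈ Γ ∧ β ∈ Γ ∧ α ≠ β
    · refine ⟨(hfin α h.1 β h.2.1 h.2.2).toFinset, fun _ _ _ p => ?_⟩
      rw [Set.Finite.mem_toFinset, Set.mem_inter_iff]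
    · exact ⟨∅, fun h1 h2 h3 => absurd ⟨h1, h2, h3⟩ h⟩
  choose I hI using hI
  obtain ⟨l, hl⟩ := exists_shear_fst_injOn
    (V ∪ (Γ ×ˢ Γ).biUnion fun z => I z.1 z.2)
  set φ := shearEquiv l with hφ
  set Z : Set (EuclideanSpace ℝ (Fin 2)) → Set (ℝ × ℝ) :=
    fun γ => {z | (shearPolynomial l (f γ)).evalEval z.1 z.2 = 0} with hZ
  have hZmem : ∀ γ ∈ Γ, ∀ z, z ∈ Z γ ↔ φ.symm z ∈ γ := by
    intro γ hγ z
    have h1 : φ.symm z ∈ γ ↔ MvPolynomial.eval (fun i => φ.symm z i) (f γ) = 0 := by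
      constructor
      · intro h
        rw [hfZ γ hγ] at h
        exact h
      · intro h
        rw [hfZ γ hγ]
        exact h
    rw [h1, ← evalEval_shearPolynomial]
    rfl
  have hstack : ∀ γ, ∃ A : CurveStack (Z γ), A.exceptional.card ≤ K₀ ∧ ∀ x, A.height x ≤ d :=
    fun γ => exists_curveStack (shearPolynomial_ne_zero l (hf0 γ))
      (natDegree_shearPolynomial_le l (hfd γ)).1 (natDegree_shearPolynomial_le l (hfd γ)).2
  choose A hA hAd using hstack
  have hcross : ∀ α ∈ Γ, ∀ β ∈ Γ, α ≠ β → (I α β).card ≤ D := by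
    intro α hα β hβ hαβ
    set F := f α ^ 2 + f β ^ 2 with hF
    have hFd : F.totalDegree ≤ 2 * d := by
      refine (MvPolynomial.totalDegree_add _ _).trans (max_le ?_ ?_)
      · exact (MvPolynomial.totalDegree_pow _ _).trans (Nat.mul_le_mul_left 2 (hfd α))
      · exact (MvPolynomial.totalDegree_pow _ _).trans (Nat.mul_le_mul_left 2 (hfd β))
    have hset : {z : ℝ × ℝ | (shearPolynomial l F).evalEval z.1 z.2 = 0} =
        ((I α β).map φ.toEmbedding : Finset (ℝ × ℝ)) := by
      ext z
      rw [Finset.mem_coe, Finset.mem_map_equiv, hI α β hα hβ hαβ, ← hZmem α hα, ← hZmem β hβ]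
      change (shearPolynomial l F).evalEval z.1 z.2 = 0 ↔
        (shearPolynomial l (f α)).evalEval z.1 z.2 = 0 ∧
          (shearPolynomial l (f β)).evalEval z.1 z.2 = 0
      simp only [evalEval_shearPolynomial, hF, map_add, map_pow]
      rw [add_eq_zero_iff_of_nonneg (sq_nonneg _) (sq_nonneg _), sq_eq_zero_iff, sq_eq_zero_iff]
    have h1 := Polynomial.Bivariate.ncard_zeros_le (natDegree_shearPolynomial_le l hFd).1
      (natDegree_shearPolynomial_le l hFd).2 (by rw [hset]; exact Finset.finite_toSet _)
    rwa [hset, Set.ncard_coe_finset, Finset.card_map] at h1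
  have hmemU : ∀ α ∈ Γ, ∀ β ∈ Γ, ∀ p ∈ I α β,
      p ∈ V ∪ (Γ ×ˢ Γ).biUnion fun z => I z.1 z.2 := fun α hα β hβ p hp =>
    mem_union_right _ (mem_biUnion.2 ⟨(α, β), mem_product.2 ⟨hα, hβ⟩, hp⟩)
  have hmain := hbound (V.map φ.toEmbedding) Γ Z ?_ ?_ ?_
  · rw [Finset.card_map] at hmain
    refine le_of_eq_of_le (sum_congr rfl fun γ hγ => ?_) hmain
    have : (V : Set (EuclideanSpace ℝ (Fin 2))) ∩ γ =
        (V.filter fun p => p ∈ γ : Finset (EuclideanSpace ℝ (Fin 2))) := by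
      ext p
      simp
    rw [this, Set.ncard_coe_finset, Finset.filter_map, Finset.card_map]
    congr 2
    refine filter_congr fun p _ => ?_
    rw [Function.comp_apply, hZmem γ hγ]
    simp
  · intro V' hV'
    refine ⟨CurveStack.cellDecomposition (d := d) (K₀ := K₀) (D := D) A
      (fun α β => (I α β).image fun p => (φ p).1) (fun γ _ => hA γ) (fun γ _ => hAd γ)
      (fun α hα β hβ hαβ => card_image_le.trans (hcross α hα β hβ hαβ)) ?_ ?_ ?_⟩
    · intro α hα β hβ hαβ z hzα hzβ
      rw [hZmem α hα] at hzα
      rw [hZmem β hβ] at hzβ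
      exact mem_image.2 ⟨φ.symm z, (hI α β hα hβ hαβ _).2 ⟨hzα, hzβ⟩, by simp⟩
    · intro p hp q hq hpq
      obtain ⟨p', hp', rfl⟩ := mem_map.1 (hV' hp)
      obtain ⟨q', hq', rfl⟩ := mem_map.1 (hV' hq)
      exact congrArg φ (hl p' (mem_union_left _ hp') q' (mem_union_left _ hq') hpq)
    · intro p hp α hα β hβ hαβ hX
      obtain ⟨p', hp', rfl⟩ := mem_map.1 (hV' hp)
      obtain ⟨q, hq, hqp⟩ := mem_image.1 hX
      obtain rfl := hl q (hmemU α hα β hβ q hq) p' (mem_union_left _ hp') hqp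
      have := (hI α β hα hβ hαβ q).1 hq
      rw [hZmem α hα, hZmem β hβ]
      simpa using this
  · intro α hα β hβ hαβ
    refine le_trans ?_ (hcross α hα β hβ hαβ)
    rw [← Finset.card_map φ.toEmbedding]
    refine card_le_card fun z hz => ?_
    rw [mem_filter, hZmem α hα, hZmem β hβ] at hz
    rw [mem_map_equiv, hI α β hα hβ hαβ]
    exact hz.2
  · intro T _ hT
    refine le_trans (card_le_card fun γ hγ => ?_) (hdof (T.map φ.symm.toEmbedding)
      (by rw [Finset.card_map, hT]))
    rw [mem_filter] at hγ ⊢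
    refine ⟨hγ.1, fun p hp => ?_⟩
    obtain ⟨z, hz, rfl⟩ := mem_map.1 (mem_coe.1 hp)
    exact (hZmem γ hγ.1 z).1 (hγ.2 z hz)

end PlaneCurves

section Multiplicities

open Finset

lemma Real.sum_rpow_le_card_rpow_mul {ι : Type*} (s : Finset ι) {f : ι → ℝ}
    (hf : ∀ i ∈ s, 0 ≤ f i) {b : ℝ} (hb : 0 < b) (hb1 : b ≤ 1) :
    ∑ i ∈ s, f i ^ b ≤ (#s : ℝ) ^ (1 - b) * (∑ i ∈ s, f i) ^ b := by
  have h1 := Real.rpow_sum_le_const_mul_sum_rpow s (fun i => f i ^ b)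
    (show 1 ≤ 1 / b from (one_le_div hb).2 hb1)
  have h2 : ∀ i ∈ s, |f i ^ b| = f i ^ b := fun i hi =>
    abs_of_nonneg (Real.rpow_nonneg (hf i hi) b)
  have h3 : ∀ i ∈ s, |f i ^ b| ^ (1 / b) = f i := fun i hi => by
    rw [h2 i hi, ← Real.rpow_mul (hf i hi), mul_one_div_cancel hb.ne', Real.rpow_one]
  rw [sum_congr rfl h2, sum_congr rfl h3] at h1
  have h0 : 0 ≤ ∑ i ∈ s, f i ^ b := sum_nonneg fun i hi => Real.rpow_nonneg (hf i hi) b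
  have h4 := Real.rpow_le_rpow (Real.rpow_nonneg h0 _) h1 hb.le
  rw [← Real.rpow_mul h0, one_div_mul_cancel hb.ne', Real.rpow_one,
    Real.mul_rpow (Real.rpow_nonneg (Nat.cast_nonneg _) _) (sum_nonneg hf),
    ← Real.rpow_mul (Nat.cast_nonneg _), sub_mul, one_div_mul_cancel hb.ne', one_mul] at h4
  exact h4

lemma Finset.sum_mul_eq_sum_range_filter {ι R : Type*} [Semiring R] (s : Finset ι)
    {m : ι → ℕ} {t : ℕ} (hm : ∀ i ∈ s, m i ≤ t) (g : ι → R) :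
    ∑ i ∈ s, (m i : R) * g i = ∑ τ ∈ range t, ∑ i ∈ s with τ < m i, g i := by
  simp only [sum_filter]
  rw [sum_comm]
  refine sum_congr rfl fun i hi => ?_
  rw [← sum_filter, sum_const, nsmul_eq_mul]
  congr 2
  have : (range t).filter (fun τ => τ < m i) = range (m i) := by
    ext τ
    have := hm i hi
    simp only [mem_filter, mem_range]
    omega
  rw [this, card_range]

end Multiplicities

/-- Incidence bound for a multiset of algebraic curves with `k` degrees of freedom and
maximum multiplicity `t` (Corollary of the Pach–Sharir theorem). -/
theorem incidence_bound_multiset_curves (d k s : ℕ) (hd : 1 ≤ d) (hk : 2 ≤ k) (hs : 1 ≤ s) :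
    ∃ C : ℝ, 0 < C ∧
      ∀ (V : Finset (EuclideanSpace ℝ (Fin 2)))
        (Γ₀ : Finset (Set (EuclideanSpace ℝ (Fin 2))))
        (m : Set (EuclideanSpace ℝ (Fin 2)) → ℕ) (t : ℕ),
        -- every element of Γ₀ is a plane algebraic curve of degree at most d
        (∀ γ ∈ Γ₀, ∃ f : MvPolynomial (Fin 2) ℝ, f ≠ 0 ∧ f.totalDegree ≤ d ∧
            γ = {x : EuclideanSpace ℝ (Fin 2) | MvPolynomial.eval (fun i => x i) f = 0}) →
        -- any two distinct curves of Γ₀ have finite intersection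
        (∀ γ₁ ∈ Γ₀, ∀ γ₂ ∈ Γ₀, γ₁ ≠ γ₂ → (γ₁ ∩ γ₂).Finite) →
        -- any k distinct points lie on at most s curves of Γ₀
        (∀ S : Finset (EuclideanSpace ℝ (Fin 2)), S.card = k →
            ({γ : Set (EuclideanSpace ℝ (Fin 2)) | γ ∈ Γ₀ ∧
              (S : Set (EuclideanSpace ℝ (Fin 2))) ⊆ γ}).ncard ≤ s) →
        -- multiplicities lie between 1 and t
        (∀ γ ∈ Γ₀, 1 ≤ m γ ∧ m γ ≤ t) →
        -- incidence bound, with M = ∑ γ ∈ Γ₀, m γ the total multiset size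
        ((∑ γ ∈ Γ₀, m γ * ((V : Set (EuclideanSpace ℝ (Fin 2))) ∩ γ).ncard : ℕ) : ℝ) ≤
          C * ((t : ℝ) ^ ((1 : ℝ) / (2 * (k : ℝ) - 1)) *
                (V.card : ℝ) ^ ((k : ℝ) / (2 * (k : ℝ) - 1)) *
                ((∑ γ ∈ Γ₀, m γ : ℕ) : ℝ) ^ ((2 * (k : ℝ) - 2) / (2 * (k : ℝ) - 1)) +
              (t : ℝ) * (V.card : ℝ) +
              (1 + Real.logb 2 (t : ℝ)) * ((∑ γ ∈ Γ₀, m γ : ℕ) : ℝ)) := by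
  classical
  obtain ⟨C, hC, hbound⟩ := exists_incidence_bound_curves d k s (by omega)
  refine ⟨C, hC, fun V Γ₀ m t halg hfin hdof hm => ?_⟩
  have hk' : (2 : ℝ) ≤ k := by exact_mod_cast hk
  have hden : 0 < 2 * (k : ℝ) - 1 := by linarith
  set a := (k : ℝ) / (2 * (k : ℝ) - 1)
  set b := (2 * (k : ℝ) - 2) / (2 * (k : ℝ) - 1) with hb
  have hb0 : 0 < b := div_pos (by linarith) hden
  have hb1 : b ≤ 1 := (div_le_one hden).2 (by linarith)
  have hb' : 1 / (2 * (k : ℝ) - 1) = 1 - b := by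
    rw [hb]
    field_simp
    ring
  rw [hb']
  set M : ℝ := ((∑ γ ∈ Γ₀, m γ : ℕ) : ℝ) with hM
  set n : ℕ → ℝ := fun τ => ((Γ₀.filter fun γ => τ < m γ).card : ℝ) with hn
  have hnM : ∑ τ ∈ Finset.range t, n τ = M := by
    have h1 := Finset.sum_mul_eq_sum_range_filter Γ₀ (fun γ hγ => (hm γ hγ).2) fun _ => (1 : ℝ)
    simp only [mul_one, Finset.sum_const, nsmul_eq_mul] at h1
    rw [hM, Nat.cast_sum, h1]
  have hlevel : ∀ τ, ∑ γ ∈ Γ₀ with τ < m γ,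
      (((V : Set (EuclideanSpace ℝ (Fin 2))) ∩ γ).ncard : ℝ) ≤
        C * ((V.card : ℝ) ^ a * n τ ^ b + V.card + n τ) := by
    intro τ
    have hsub : Γ₀.filter (fun γ => τ < m γ) ⊆ Γ₀ := Finset.filter_subset _ _
    have h1 := hbound V (Γ₀.filter fun γ => τ < m γ) (fun γ hγ => halg γ (hsub hγ))
      (fun α hα β hβ => hfin α (hsub hα) β (hsub hβ)) fun S hS => ?_
    · convert h1
    · refine le_trans ?_ (hdof S hS)
      rw [← Set.ncard_coe_finset]
      refine Set.ncard_le_ncard (fun γ hγ => ?_) (Γ₀.finite_toSet.subset fun γ hγ => hγ.1)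
      rw [Finset.mem_coe, Finset.mem_filter] at hγ
      exact ⟨hsub hγ.1, hγ.2⟩
  have hpow : ∑ τ ∈ Finset.range t, n τ ^ b ≤ (t : ℝ) ^ (1 - b) * M ^ b := by
    have h1 := Real.sum_rpow_le_card_rpow_mul (Finset.range t) (f := n)
      (fun τ _ => Nat.cast_nonneg _) hb0 hb1
    rwa [Finset.card_range, hnM] at h1
  have hlog : M ≤ (1 + Real.logb 2 (t : ℝ)) * M := by
    have hM0 : 0 ≤ M := Nat.cast_nonneg _
    have hlog0 : 0 ≤ Real.logb 2 (t : ℝ) := by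
      rcases Nat.eq_zero_or_pos t with ht | ht
      · simp [ht]
      · exact Real.logb_nonneg one_lt_two (by exact_mod_cast ht)
    linarith [mul_nonneg hlog0 hM0]
  push_cast
  rw [Finset.sum_mul_eq_sum_range_filter Γ₀ (fun γ hγ => (hm γ hγ).2)]
  calc _ ≤ ∑ τ ∈ Finset.range t, C * ((V.card : ℝ) ^ a * n τ ^ b + V.card + n τ) :=
        Finset.sum_le_sum fun τ _ => hlevel τ
    _ = C * ((V.card : ℝ) ^ a * ∑ τ ∈ Finset.range t, n τ ^ b + t * V.card + M) := by
        rw [← Finset.mul_sum, Finset.sum_add_distrib, Finset.sum_add_distrib, ← Finset.mul_sum,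
          hnM, Finset.sum_const, Finset.card_range, nsmul_eq_mul]
    _ ≤ C * ((V.card : ℝ) ^ a * ((t : ℝ) ^ (1 - b) * M ^ b) + t * V.card +
          (1 + Real.logb 2 (t : ℝ)) * M) := by
        gcongr
    _ = _ := by
        rw [hM]
        push_cast
        ring
end

section
/- There exists an absolute constant c > 0 such that the following holds. Let A, B be finite subsets of ℝ with |A| ≥ 2 and B nonempty, and let P = (A × {0}) ∪ ({0} × B) ⊂ ℝ² (points of A placed on the x-axis and points of B placed on the y-axis). Then P determines at least c · |A| · |B|^{1/4} distinct distances. (Hence if a point set with o(n) distinct distances has Ω(n^α) points on a line, then no line perpendicular to it contains Ω(n^β) points with α + β/4 ≥ 1.) -/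
open Finset

/-- In a finite set of reals, each `x` has at most `k` successors within `k` steps. -/
lemma card_pairs_within_steps_le (X : Finset ℝ) (k : ℕ) :
    #{p ∈ X ×ˢ X | p.1 < p.2 ∧ #{z ∈ X | p.1 < z ∧ z ≤ p.2} ≤ k} ≤ #X * k := by
  classical
  rw [card_eq_sum_card_fiberwise (f := Prod.fst) (t := X)]
  · rw [← smul_eq_mul]
    refine sum_le_card_nsmul _ _ _ fun x _ => ?_
    have h := card_le_card_of_injOn (t := Finset.Icc 1 k)
      (s := {p ∈ {p ∈ X ×ˢ X | p.1 < p.2 ∧ #{z ∈ X | p.1 < z ∧ z ≤ p.2} ≤ k} | p.1 = x})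
      (fun p => #{z ∈ X | p.1 < z ∧ z ≤ p.2}) ?_ ?_
    · simpa using h
    · rintro ⟨a, b⟩ hp
      simp only [coe_filter, mem_filter, mem_product, Set.mem_ofPred_eq] at hp
      simp only [coe_Icc, Set.mem_Icc]
      exact ⟨card_pos.2 ⟨b, mem_filter.2 ⟨hp.1.1.2, hp.1.2.1, le_rfl⟩⟩, hp.1.2.2⟩
    · have key : ∀ a b b' : ℝ, a < b → b < b' → b' ∈ X →
          #{z ∈ X | a < z ∧ z ≤ b} < #{z ∈ X | a < z ∧ z ≤ b'} := by
        intro a b b' hab hb hX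
        refine card_lt_card ⟨fun z hz => ?_, fun hs => ?_⟩
        · simp only [mem_filter] at hz ⊢
          exact ⟨hz.1, hz.2.1, hz.2.2.trans hb.le⟩
        · have : b' ∈ ({z ∈ X | a < z ∧ z ≤ b} : Finset ℝ) :=
            hs (by simp only [mem_filter]; exact ⟨hX, hab.trans hb, le_rfl⟩)
          simp only [mem_filter] at this
          exact absurd this.2.2 (not_le.2 hb)
      rintro ⟨a, b⟩ hp ⟨a', b'⟩ hp' heq
      simp only [coe_filter, mem_filter, mem_product, Set.mem_ofPred_eq] at hp hp' heq
      obtain ⟨⟨⟨-, hb⟩, hab, -⟩, rfl⟩ := hp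
      obtain ⟨⟨⟨-, hb'⟩, hab', -⟩, rfl⟩ := hp'
      rcases lt_trichotomy b b' with h | h | h
      · exact absurd heq (key _ _ _ hab h hb').ne
      · rw [h]
      · exact absurd heq (key _ _ _ hab' h hb).ne'
  · intro p hp
    simp only [coe_filter, mem_product, Set.mem_ofPred_eq] at hp
    exact hp.1.1

/-- Few gaps of a shifted increasing sequence contain many points of a finite set. -/
lemma card_long_gaps_mul_le {N : ℕ} {u : Fin (N + 1) → ℝ} (hu : StrictMono u) (X : Finset ℝ)
    (b : ℝ) (k : ℕ) :
    #{i : Fin N | k < #{z ∈ X | u i.castSucc + b < z ∧ z ≤ u i.succ + b}} * (k + 1) ≤ #X := by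
  classical
  set S : Finset (Fin N) := {i | k < #{z ∈ X | u i.castSucc + b < z ∧ z ≤ u i.succ + b}} with hS
  have hdisj : ∀ i j : Fin N, i < j →
      Disjoint ({z ∈ X | u i.castSucc + b < z ∧ z ≤ u i.succ + b} : Finset ℝ)
        {z ∈ X | u j.castSucc + b < z ∧ z ≤ u j.succ + b} := by
    intro i j hij
    rw [disjoint_left]
    intro z hz hz'
    simp only [mem_filter] at hz hz'
    have : u i.succ ≤ u j.castSucc := hu.monotone (by
      rw [Fin.le_def, Fin.val_succ, Fin.val_castSucc]
      exact hij)
    linarith [hz.2.2, hz'.2.1]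
  calc #S * (k + 1) ≤ ∑ i ∈ S, #{z ∈ X | u i.castSucc + b < z ∧ z ≤ u i.succ + b} := by
        rw [← smul_eq_mul]
        refine card_nsmul_le_sum _ _ _ fun i hi => ?_
        simpa [hS] using hi
    _ = #(S.biUnion fun i => {z ∈ X | u i.castSucc + b < z ∧ z ≤ u i.succ + b}) := by
        rw [card_biUnion]
        intro i _ j _ hij
        rcases lt_or_gt_of_ne hij with h | h
        · exact hdisj i j h
        · exact (hdisj j i h).symm
    _ ≤ #X := card_le_card (biUnion_subset.2 fun i _ => filter_subset _ _)

/-- At most a quarter of the gaps contain more than `4 * #X / N` points. -/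
lemma four_mul_card_long_gaps_le {N : ℕ} {u : Fin (N + 1) → ℝ} (hu : StrictMono u) (X : Finset ℝ)
    (b : ℝ) :
    4 * #{i : Fin N | 4 * #X / N < #{z ∈ X | u i.castSucc + b < z ∧ z ≤ u i.succ + b}} ≤ N := by
  have h := card_long_gaps_mul_le hu X b (4 * #X / N)
  rcases Nat.eq_zero_or_pos N with rfl | hN
  · simp
  set m := #{i : Fin N | 4 * #X / N < #{z ∈ X | u i.castSucc + b < z ∧ z ≤ u i.succ + b}}
  have h1 : 4 * #X < N * (4 * #X / N + 1) := Nat.lt_mul_div_succ _ hN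
  by_contra! hc
  have h2 : N * (4 * #X / N + 1) ≤ 4 * m * (4 * #X / N + 1) := Nat.mul_le_mul_right _ hc.le
  nlinarith

/-- An elementary incidence-type bound for sums of two monotone sequences whose consecutive
difference pairs are distinct (Ruzsa, Shakan, Solymosi, Szemerédi). -/
lemma pow_three_mul_card_mul_card_le {N : ℕ} {u v : Fin (N + 1) → ℝ} (hu : StrictMono u)
    (hv : StrictMono v)
    (hinj : ∀ i j : Fin N, u i.succ - u i.castSucc = u j.succ - u j.castSucc →
      v i.succ - v i.castSucc = v j.succ - v j.castSucc → i = j)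
    {B C X Y : Finset ℝ} (hX : ∀ i, ∀ b ∈ B, u i + b ∈ X) (hY : ∀ i, ∀ c ∈ C, v i + c ∈ Y) :
    N ^ 3 * #B * #C ≤ 32 * #X ^ 2 * #Y ^ 2 := by
  classical
  set k := 4 * #X / N
  set l := 4 * #Y / N
  let f : Fin N → ℝ → ℕ := fun i b => #{z ∈ X | u i.castSucc + b < z ∧ z ≤ u i.succ + b}
  let g : Fin N → ℝ → ℕ := fun i c => #{z ∈ Y | v i.castSucc + c < z ∧ z ≤ v i.succ + c}
  have hgap : ∀ b c, N ≤ 2 * #{i : Fin N | f i b ≤ k ∧ g i c ≤ l} := by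
    intro b c
    have h1 : 4 * #{i : Fin N | k < f i b} ≤ N := four_mul_card_long_gaps_le hu X b
    have h2 : 4 * #{i : Fin N | l < g i c} ≤ N := four_mul_card_long_gaps_le hv Y c
    have h3 : N ≤ #{i : Fin N | f i b ≤ k ∧ g i c ≤ l} +
        (#{i : Fin N | k < f i b} + #{i : Fin N | l < g i c}) := by
      calc N = #(univ : Finset (Fin N)) := by simp
        _ ≤ #(({i : Fin N | f i b ≤ k ∧ g i c ≤ l} : Finset (Fin N)) ∪
              (({i : Fin N | k < f i b} : Finset (Fin N)) ∪
                ({i : Fin N | l < g i c} : Finset (Fin N)))) := by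
            refine card_le_card fun i _ => ?_
            simp only [mem_union, mem_filter, mem_univ, true_and]
            omega
        _ ≤ _ := (card_union_le _ _).trans (Nat.add_le_add_left (card_union_le _ _) _)
    omega
  let T : Finset ((ℝ × ℝ) × Fin N) :=
    {t ∈ (B ×ˢ C) ×ˢ univ | f t.2 t.1.1 ≤ k ∧ g t.2 t.1.2 ≤ l}
  have hlow : N * (#B * #C) ≤ 2 * #T := by
    have hT : #T = ∑ p ∈ B ×ˢ C, #{i : Fin N | f i p.1 ≤ k ∧ g i p.2 ≤ l} := by
      simp only [T, card_filter, sum_product]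
    rw [hT, mul_sum, ← card_product, mul_comm, ← smul_eq_mul]
    exact card_nsmul_le_sum _ _ _ fun p _ => hgap p.1 p.2
  have hup : #T ≤ (#X * k) * (#Y * l) := by
    refine le_trans ?_ (Nat.mul_le_mul (card_pairs_within_steps_le X k)
      (card_pairs_within_steps_le Y l))
    rw [← card_product]
    refine card_le_card_of_injOn (fun t =>
      ((u t.2.castSucc + t.1.1, u t.2.succ + t.1.1),
        (v t.2.castSucc + t.1.2, v t.2.succ + t.1.2))) ?_ ?_
    · rintro ⟨⟨b, c⟩, i⟩ ht
      simp only [T, coe_filter, mem_product, Set.mem_ofPred_eq, mem_univ, and_true] at ht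
      simp only [mem_coe, mem_product, mem_filter, add_lt_add_iff_right]
      exact ⟨⟨⟨hX _ _ ht.1.1, hX _ _ ht.1.1⟩, hu i.castSucc_lt_succ, ht.2.1⟩,
        ⟨⟨hY _ _ ht.1.2, hY _ _ ht.1.2⟩, hv i.castSucc_lt_succ, ht.2.2⟩⟩
    · rintro ⟨⟨b, c⟩, i⟩ - ⟨⟨b', c'⟩, j⟩ - heq
      simp only [Prod.mk.injEq] at heq
      obtain ⟨⟨h1, h2⟩, h3, h4⟩ := heq
      obtain rfl := hinj i j (by linarith) (by linarith)
      simp only [Prod.mk.injEq, and_true]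
      exact ⟨by linarith, by linarith⟩
  have hk : N * k ≤ 4 * #X := Nat.mul_div_le _ _
  have hl : N * l ≤ 4 * #Y := Nat.mul_div_le _ _
  calc N ^ 3 * #B * #C = N ^ 2 * (N * (#B * #C)) := by ring
    _ ≤ N ^ 2 * (2 * ((#X * k) * (#Y * l))) :=
        Nat.mul_le_mul_left _ (hlow.trans (Nat.mul_le_mul_left _ hup))
    _ = 2 * #X * #Y * ((N * k) * (N * l)) := by ring
    _ ≤ 2 * #X * #Y * ((4 * #X) * (4 * #Y)) := by gcongr
    _ = 32 * #X ^ 2 * #Y ^ 2 := by ring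

/-- A set of nonnegative reals cannot have both few differences and few sums `a ^ 2 + c`. -/
lemma card_le_card_sub_sq_mul_card_sq_add_sq {N : ℕ} {A C X Y : Finset ℝ} (hA : #A = N + 1)
    (hpos : ∀ a ∈ A, 0 ≤ a) (hX : ∀ a ∈ A, ∀ b ∈ A, a - b ∈ X)
    (hY : ∀ a ∈ A, ∀ c ∈ C, a ^ 2 + c ∈ Y) :
    N ^ 3 * (N + 1) * #C ≤ 32 * #X ^ 2 * #Y ^ 2 := by
  classical
  have hmem : ∀ i, A.orderEmbOfFin hA i ∈ A := A.orderEmbOfFin_mem hA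
  have hu : StrictMono (A.orderEmbOfFin hA) := (A.orderEmbOfFin hA).strictMono
  generalize (A.orderEmbOfFin hA : Fin (N + 1) → ℝ) = u at hmem hu
  have h := pow_three_mul_card_mul_card_le (u := u) (v := fun i => u i ^ 2) hu
    (fun i j hij => pow_lt_pow_left₀ (hu hij) (hpos _ (hmem i)) two_ne_zero) ?_
    (B := A.image Neg.neg) (C := C) (X := X) (Y := Y) ?_ fun i c hc => hY _ (hmem i) c hc
  · rwa [card_image_of_injective _ neg_injective, hA] at h
  · intro i j h1 h2
    have hd : u i.castSucc < u i.succ := hu i.castSucc_lt_succ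
    have hs : u i.succ + u i.castSucc = u j.succ + u j.castSucc := by
      apply mul_left_cancel₀ (sub_ne_zero.2 hd.ne')
      rw [show (u i.succ - u i.castSucc) * (u j.succ + u j.castSucc) =
        (u j.succ - u j.castSucc) * (u j.succ + u j.castSucc) by rw [h1]]
      linear_combination h2
    exact Fin.castSucc_injective _ (hu.injective (by linarith))
  · intro i b hb
    obtain ⟨a, ha, rfl⟩ := mem_image.1 hb
    simpa [sub_eq_add_neg] using hX _ (hmem i) a ha

lemma card_le_two_mul_card_image_sq (B : Finset ℝ) : #B ≤ 2 * #(B.image (· ^ 2)) := by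
  classical
  refine card_le_mul_card_image B 2 fun c hc => ?_
  obtain ⟨b, -, rfl⟩ := mem_image.1 hc
  refine (card_le_card (t := {b, -b}) fun x hx => ?_).trans card_le_two
  simpa [sq_eq_sq_iff_eq_or_eq_neg] using (mem_filter.1 hx).2

/-- Up to reflection, at least half of a finite set of reals is nonnegative. -/
lemma exists_nonneg_half (A : Finset ℝ) : ∃ A' : Finset ℝ, #A ≤ 2 * #A' ∧ (∀ a ∈ A', 0 ≤ a) ∧
    ((∀ a ∈ A', a ∈ A) ∨ ∀ a ∈ A', -a ∈ A) := by
  classical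
  have h := card_filter_add_card_filter_not (s := A) (fun a => 0 ≤ a)
  rcases le_total #{a ∈ A | ¬ 0 ≤ a} #{a ∈ A | 0 ≤ a} with hle | hle
  · exact ⟨{a ∈ A | 0 ≤ a}, by omega, by simp, Or.inl (by simp +contextual)⟩
  · refine ⟨({a ∈ A | ¬ 0 ≤ a} : Finset ℝ).image Neg.neg, ?_, ?_, Or.inr ?_⟩
    · rw [card_image_of_injective _ neg_injective]; omega
    · simp only [mem_image, mem_filter]
      rintro _ ⟨a, ha, rfl⟩
      linarith [not_le.1 ha.2]
    · simp only [mem_image, mem_filter]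
      rintro _ ⟨a, ha, rfl⟩
      simpa using ha.1

/-- The bound for a finite set `D` of reals containing all nonzero distances. -/
lemma card_pow_four_mul_card_le {A B D : Finset ℝ} (hA : 2 ≤ #A)
    (hAA : ∀ a ∈ A, ∀ a' ∈ A, a ≠ a' → |a - a'| ∈ D)
    (hAB : ∀ a ∈ A, ∀ b ∈ B, a ^ 2 + b ^ 2 ≠ 0 → √(a ^ 2 + b ^ 2) ∈ D) :
    #A ^ 4 * #B ≤ (28 * #D) ^ 4 := by
  classical
  set C := B.image (· ^ 2)
  have hC : #B ≤ 2 * #C := card_le_two_mul_card_image_sq B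
  set X := insert 0 (D ∪ D.image Neg.neg)
  set Y := insert 0 (D.image (· ^ 2))
  have hX : ∀ a ∈ A, ∀ a' ∈ A, a - a' ∈ X := by
    intro a ha a' ha'
    rcases eq_or_ne a a' with rfl | hne
    · simp [X]
    · have h := hAA a ha a' ha' hne
      rcases abs_choice (a - a') with h' | h' <;> rw [h'] at h
      · simp [X, h]
      · simp only [X, mem_insert, mem_union, mem_image]
        exact Or.inr (Or.inr ⟨_, h, neg_neg _⟩)
  have hY : ∀ a ∈ A, ∀ c ∈ C, a ^ 2 + c ∈ Y := by
    intro a ha c hc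
    obtain ⟨b, hb, rfl⟩ := mem_image.1 hc
    simp only [Y, mem_insert, mem_image]
    by_cases h0 : a ^ 2 + b ^ 2 = 0
    · exact Or.inl h0
    · exact Or.inr ⟨_, hAB a ha b hb h0, Real.sq_sqrt (by positivity)⟩
  obtain ⟨a₀, ha₀, a₁, ha₁, hne⟩ := one_lt_card.1 hA
  have hD : 1 ≤ #D := card_pos.2 ⟨_, hAA _ ha₀ _ ha₁ hne⟩
  have hXD : #X ≤ 3 * #D := by
    have h1 : #X ≤ _ := card_insert_le _ _
    have h2 := card_union_le D (D.image Neg.neg)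
    have h3 : #(D.image Neg.neg) ≤ #D := card_image_le
    omega
  have hYD : #Y ≤ 2 * #D := by
    have h1 : #Y ≤ _ := card_insert_le _ _
    have h3 : #(D.image (· ^ 2)) ≤ #D := card_image_le
    omega
  obtain ⟨A', hA', hpos, hsub⟩ := exists_nonneg_half A
  obtain ⟨N, hN⟩ : ∃ N, #A' = N + 1 := ⟨#A' - 1, by omega⟩
  have hD4 : #D ≤ #D ^ 4 := Nat.le_self_pow (by norm_num) _
  rcases Nat.eq_zero_or_pos N with rfl | hN0
  · have hA2 : #A = 2 := by omega
    have hCY : #C ≤ #Y := card_le_card_of_injOn (a₀ ^ 2 + ·) (hY a₀ ha₀)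
      (add_right_injective _).injOn
    rw [hA2, mul_pow]
    omega
  · have h : N ^ 3 * (N + 1) * #C ≤ 32 * #X ^ 2 * #Y ^ 2 := by
      refine card_le_card_sub_sq_mul_card_sq_add_sq hN hpos ?_ ?_
      · intro a ha b hb
        rcases hsub with hs | hs
        · exact hX _ (hs a ha) _ (hs b hb)
        · simpa [add_comm, sub_eq_add_neg] using hX _ (hs b hb) _ (hs a ha)
      · intro a ha c hc
        rcases hsub with hs | hs
        · exact hY _ (hs a ha) c hc
        · simpa using hY _ (hs a ha) c hc
    have hAN : #A ≤ 4 * N := by omega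
    calc #A ^ 4 * #B ≤ (4 * N) ^ 4 * (2 * #C) := by gcongr
      _ = 512 * (N ^ 3 * N * #C) := by ring
      _ ≤ 512 * (N ^ 3 * (N + 1) * #C) := by gcongr; omega
      _ ≤ 512 * (32 * #X ^ 2 * #Y ^ 2) := by gcongr
      _ ≤ 512 * (32 * (3 * #D) ^ 2 * (2 * #D) ^ 2) := by gcongr
      _ = 589824 * #D ^ 4 := by ring
      _ ≤ (28 * #D) ^ 4 := by rw [mul_pow]; gcongr; norm_num


/-- Points `A` on the x-axis together with points `B` on the y-axis determine
`Ω(|A| · |B|^(1/4))` distinct distances. -/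
theorem distances_between_two_perpendicular_lines :
    ∃ c : ℝ, 0 < c ∧
      ∀ A B : Finset ℝ, 2 ≤ A.card → B.Nonempty →
      ∀ P : Set (EuclideanSpace ℝ (Fin 2)),
        P = (fun a : ℝ => (WithLp.equiv 2 (Fin 2 → ℝ)).symm ![a, 0]) '' (A : Set ℝ) ∪
            (fun b : ℝ => (WithLp.equiv 2 (Fin 2 → ℝ)).symm ![0, b]) '' (B : Set ℝ) →
        c * (A.card : ℝ) * (B.card : ℝ) ^ ((1 : ℝ) / 4) ≤
          (({d : ℝ | ∃ p ∈ P, ∃ q ∈ P, p ≠ q ∧ d = dist p q}).ncard : ℝ) := by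
  classical
  refine ⟨1 / 28, by norm_num, ?_⟩
  rintro A B hA - P rfl
  set P : Set (EuclideanSpace ℝ (Fin 2)) :=
    (fun a : ℝ => (WithLp.equiv 2 (Fin 2 → ℝ)).symm ![a, 0]) '' (A : Set ℝ) ∪
      (fun b : ℝ => (WithLp.equiv 2 (Fin 2 → ℝ)).symm ![0, b]) '' (B : Set ℝ)
  have hPfin : P.Finite := (A.finite_toSet.image _).union (B.finite_toSet.image _)
  have hfin : {d : ℝ | ∃ p ∈ P, ∃ q ∈ P, p ≠ q ∧ d = dist p q}.Finite := by
    refine ((hPfin.prod hPfin).image fun x => dist x.1 x.2).subset ?_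
    rintro _ ⟨p, hp, q, hq, -, rfl⟩
    exact ⟨(p, q), ⟨hp, hq⟩, rfl⟩
  rw [Set.ncard_eq_toFinset_card _ hfin]
  have key := card_pow_four_mul_card_le (A := A) (B := B) (D := hfin.toFinset) hA ?_ ?_
  · have key' : ((#A : ℝ)) ^ 4 * #B ≤ (28 * (#hfin.toFinset : ℝ)) ^ 4 := by exact_mod_cast key
    have hpow : (((#B : ℝ)) ^ ((1 : ℝ) / 4)) ^ 4 = #B := by
      rw [← Real.rpow_natCast, ← Real.rpow_mul (by positivity)]
      norm_num
    have h : (#A : ℝ) * (#B : ℝ) ^ ((1 : ℝ) / 4) ≤ 28 * (#hfin.toFinset : ℝ) := by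
      refine le_of_pow_le_pow_left₀ (n := 4) (by norm_num) (by positivity) ?_
      rwa [mul_pow, hpow]
    linarith
  · intro a ha a' ha' hne
    rw [Set.Finite.mem_toFinset]
    refine ⟨_, Or.inl ⟨a, ha, rfl⟩, _, Or.inl ⟨a', ha', rfl⟩, fun h => hne ?_, ?_⟩
    · simpa using congrArg (fun p : EuclideanSpace ℝ (Fin 2) => p 0) h
    · simp [EuclideanSpace.dist_eq, Real.dist_eq, Real.sqrt_sq_eq_abs]
  · intro a ha b hb hne
    rw [Set.Finite.mem_toFinset]
    refine ⟨_, Or.inl ⟨a, ha, rfl⟩, _, Or.inr ⟨b, hb, rfl⟩, fun h => hne ?_, ?_⟩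
    · have h0 : a = 0 := by simpa using congrArg (fun p : EuclideanSpace ℝ (Fin 2) => p 0) h
      have h1 : 0 = b := by simpa using congrArg (fun p : EuclideanSpace ℝ (Fin 2) => p 1) h
      simp [h0, ← h1]
    · simp [EuclideanSpace.dist_eq, Real.dist_eq]
end
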